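/- arXiv:1102.0697 — 4 statements merged into one kernel-verified Lean document; each statement's English description precedes it below -/
import Mathlib

section
/- Let k ∈ ℕ, let G be a locally finite graph, and let ω be an end of G. Then the vertex-degree of ω equals k if and only if k is the smallest integer such that every finite set S ⊆ V(G) can be separated from ω by a separator of size k. -/
open SimpleGraph Cardinal

universe u v

variable {V : Type u}

/-- A ray in `G`: an injective sequence of vertices with consecutive vertices adjacent. -/
def IsRay (G : SimpleGraph V) (f : ℕ → V) : Prop :=
  Function.Injective f ∧ ∀ n : ℕ, G.Adj (f n) (f (n + 1))

/-- Two rays are equivalent (belong to the same end) if no finite vertex set separates them: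
for every finite `S` there are arbitrarily late vertices of the two rays joined by a walk
avoiding `S`. -/
def RayEquiv (G : SimpleGraph V) (f g : ℕ → V) : Prop :=
  ∀ S : Finset V, ∀ m₀ n₀ : ℕ, ∃ m n : ℕ, m₀ ≤ m ∧ n₀ ≤ n ∧
    ∃ w : G.Walk (f m) (g n), ∀ x ∈ w.support, x ∉ S

/-- `G` has `H` as a minor: disjoint nonempty connected branch sets, one for each vertex of
`H`, with edges of `G` between branch sets corresponding to adjacent vertices of `H`. -/
def HasMinor {W : Type v} (G : SimpleGraph V) (H : SimpleGraph W) : Prop :=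
  ∃ B : W → Set V, (∀ w, (B w).Nonempty) ∧
    (Pairwise fun w w' => Disjoint (B w) (B w')) ∧
    (∀ w, (G.induce (B w)).Connected) ∧
    ∀ ⦃w w'⦄, H.Adj w w' → ∃ u ∈ B w, ∃ x ∈ B w', G.Adj u x

/-- The `[k] × ℕ` grid. -/
def gridN (k : ℕ) : SimpleGraph (Fin k × ℕ) :=
  SimpleGraph.fromRel fun a b =>
    (a.1 = b.1 ∧ b.2 = a.2 + 1) ∨ (a.2 = b.2 ∧ (b.1 : ℕ) = (a.1 : ℕ) + 1)

/-- The `ℕ × ℕ` grid. -/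
def gridNN : SimpleGraph (ℕ × ℕ) :=
  SimpleGraph.fromRel fun a b =>
    (a.1 = b.1 ∧ b.2 = a.2 + 1) ∨ (a.2 = b.2 ∧ b.1 = a.1 + 1)

/-- `G` is `k`-connected: more than `k` vertices, and deleting fewer than `k` vertices
leaves a connected graph. -/
def KConnected (G : SimpleGraph V) (k : ℕ) : Prop :=
  (k : Cardinal) < #V ∧
  ∀ S : Finset V, S.card < k → (G.induce ((S : Set V))ᶜ).Connected

/-- `G` is `k`-edge-connected: deleting fewer than `k` edges leaves a connected graph. -/
def KEdgeConnected (G : SimpleGraph V) (k : ℕ) : Prop :=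
  ∀ F : Finset (Sym2 V), F.card < k → (G.deleteEdges (F : Set (Sym2 V))).Connected

/-- There are `m` pairwise vertex-disjoint rays all in the end of the ray `f`. -/
def HasVDisjointRays (G : SimpleGraph V) (f : ℕ → V) (m : ℕ) : Prop :=
  ∃ F : Fin m → ℕ → V, (∀ i, IsRay G (F i)) ∧ (∀ i, RayEquiv G (F i) f) ∧
    Pairwise fun i j => Disjoint (Set.range (F i)) (Set.range (F j))

/-- The set of edges used by a ray. -/
def rayEdges (f : ℕ → V) : Set (Sym2 V) := Set.range fun n => s(f n, f (n + 1))

/-- There are `m` pairwise edge-disjoint rays all in the end of the ray `f`. -/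
def HasEDisjointRays (G : SimpleGraph V) (f : ℕ → V) (m : ℕ) : Prop :=
  ∃ F : Fin m → ℕ → V, (∀ i, IsRay G (F i)) ∧ (∀ i, RayEquiv G (F i) f) ∧
    Pairwise fun i j => Disjoint (rayEdges (F i)) (rayEdges (F j))

/-- `G` is `k`-connected but deleting any edge destroys `k`-connectivity. -/
def EdgeMinKConnected (G : SimpleGraph V) (k : ℕ) : Prop :=
  KConnected G k ∧ ∀ e ∈ G.edgeSet, ¬ KConnected (G.deleteEdges {e}) k

/-- `G` is `k`-connected but deleting any vertex destroys `k`-connectivity. -/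
def VertexMinKConnected (G : SimpleGraph V) (k : ℕ) : Prop :=
  KConnected G k ∧ ∀ x : V, ¬ KConnected (G.induce {x}ᶜ) k

/-- The vertex set `T` separates the finite set `S` from the end of the ray `f`: some tail
of `f` avoids `T` and no walk avoiding `T` joins that tail to `S`. -/
def CutSeparates {V : Type u} (G : SimpleGraph V) (T S : Finset V) (f : ℕ → V) : Prop :=
  ∃ N : ℕ, (∀ n, N ≤ n → f n ∉ T) ∧
    ∀ n, N ≤ n → ∀ s ∈ S, ¬ ∃ w : G.Walk (f n) s, ∀ x ∈ w.support, x ∉ T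

section EndSeparators

variable {G : SimpleGraph V} {f : ℕ → V}

/-- `u` and `v` are joined by a walk of `G` with all vertices in `P`. -/
def WalkJoined (G : SimpleGraph V) (P : Set V) (u v : V) : Prop :=
  ∃ w : G.Walk u v, ∀ x ∈ w.support, x ∈ P

namespace WalkJoined

variable {P Q X : Set V} {u v w : V}

theorem refl (h : u ∈ P) : WalkJoined G P u u := ⟨.nil, by simpa using h⟩

theorem symm (h : WalkJoined G P u v) : WalkJoined G P v u := by
  obtain ⟨p, hp⟩ := h
  exact ⟨p.reverse, by simpa using hp⟩

theorem trans (h : WalkJoined G P u v) (h' : WalkJoined G P v w) : WalkJoined G P u w := by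
  obtain ⟨p, hp⟩ := h
  obtain ⟨q, hq⟩ := h'
  refine ⟨p.append q, fun x hx => ?_⟩
  rcases (SimpleGraph.Walk.mem_support_append_iff _ _).1 hx with h | h
  exacts [hp x h, hq x h]

theorem mono (h : WalkJoined G P u v) (hPQ : P ⊆ Q) : WalkJoined G Q u v := by
  obtain ⟨p, hp⟩ := h
  exact ⟨p, fun x hx => hPQ (hp x hx)⟩

theorem of_adj (h : G.Adj u v) (hu : u ∈ P) (hv : v ∈ P) : WalkJoined G P u v :=
  ⟨h.toWalk, by simp [hu, hv]⟩

theorem left_mem (h : WalkJoined G P u v) : u ∈ P := by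
  obtain ⟨p, hp⟩ := h
  exact hp _ p.start_mem_support

theorem exists_adj_of_mem_of_notMem (h : WalkJoined G P u v) (hu : u ∈ X) (hv : v ∉ X) :
    ∃ x ∈ X, ∃ y ∉ X, G.Adj x y ∧ x ∈ P ∧ y ∈ P := by
  obtain ⟨p, hp⟩ := h
  induction p with
  | nil => exact absurd hu hv
  | @cons a b c hab q ih =>
    by_cases hb : b ∈ X
    · exact ih hb hv fun x hx => hp x (by simp [hx])
    · exact ⟨a, hu, b, hb, hab, hp a (by simp), hp b (by simp)⟩

end WalkJoined

theorem IsRay.walkJoined {g : ℕ → V} {P : Set V} (hg : IsRay G g) {m n : ℕ} (hmn : m ≤ n)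
    (h : ∀ i, m ≤ i → i ≤ n → g i ∈ P) : WalkJoined G P (g m) (g n) := by
  induction n, hmn using Nat.le_induction with
  | base => exact .refl (h m le_rfl le_rfl)
  | succ n hmn ih =>
    exact (ih fun i hi hi' => h i hi (by omega)).trans
      (.of_adj (hg.2 n) (h n hmn (by omega)) (h (n + 1) (by omega) le_rfl))

theorem IsRay.eventually_notMem (hf : IsRay G f) {S : Set V} (hS : S.Finite) :
    ∃ N, ∀ n, N ≤ n → f n ∉ S := by
  obtain ⟨N, hN⟩ := (hS.preimage hf.1.injOn).bddAbove
  exact ⟨N + 1, fun n hn h => by have := hN h; omega⟩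

/-- The component of `G - T` containing a tail of `f`. -/
def endComponent (G : SimpleGraph V) (f : ℕ → V) (T : Finset V) : Set V :=
  {v | ∃ n, (∀ m, n ≤ m → f m ∉ T) ∧ WalkJoined G {x | x ∉ T} (f n) v}

theorem notMem_of_mem_endComponent {T : Finset V} {v : V} (h : v ∈ endComponent G f T) :
    v ∉ T := by
  obtain ⟨n, -, h⟩ := h
  exact h.symm.left_mem

theorem endComponent_of_walkJoined {T : Finset V} {v w : V} (h : v ∈ endComponent G f T)
    (hvw : WalkJoined G {x | x ∉ T} v w) : w ∈ endComponent G f T := by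
  obtain ⟨n, hn, h⟩ := h
  exact ⟨n, hn, h.trans hvw⟩

theorem endComponent_of_adj {T : Finset V} {v w : V} (h : v ∈ endComponent G f T)
    (hvw : G.Adj v w) (hw : w ∉ T) : w ∈ endComponent G f T :=
  endComponent_of_walkJoined h (.of_adj hvw (notMem_of_mem_endComponent h) hw)

theorem IsRay.eventually_mem_endComponent (hf : IsRay G f) (T : Finset V) :
    ∃ N, ∀ n, N ≤ n → f n ∈ endComponent G f T := by
  obtain ⟨N, hN⟩ := hf.eventually_notMem T.finite_toSet
  exact ⟨N, fun n hn => ⟨n, fun m hm => hN m (hn.trans hm), .refl (hN n hn)⟩⟩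

theorem walkJoined_of_mem_endComponent (hf : IsRay G f) {T : Finset V} {u v : V}
    (hu : u ∈ endComponent G f T) (hv : v ∈ endComponent G f T) :
    WalkJoined G (endComponent G f T) u v := by
  have key : WalkJoined G {x | x ∉ T} u v := by
    obtain ⟨m, hm, hmu⟩ := hu
    obtain ⟨n, hn, hnv⟩ := hv
    exact (hmu.symm.trans (hf.walkJoined (le_max_left m n) fun i hi _ => hm i hi)).trans
      ((hf.walkJoined (le_max_right m n) fun i hi _ => hn i hi).symm.trans hnv)
  obtain ⟨p, hp⟩ := key
  refine ⟨p, fun x hx => endComponent_of_walkJoined hu ?_⟩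
  classical
  exact ⟨p.takeUntil x hx, fun y hy => hp y (p.support_takeUntil_subset_support hx hy)⟩

theorem endComponent_subset (hf : IsRay G f) {T T' : Finset V}
    (h : ∀ x ∈ T, x ∉ endComponent G f T') : endComponent G f T' ⊆ endComponent G f T := by
  intro v hv
  obtain ⟨M, hM⟩ := hf.eventually_mem_endComponent T
  obtain ⟨N, hN⟩ := hf.eventually_mem_endComponent T'
  refine endComponent_of_walkJoined (hM _ (le_max_left M N)) ?_
  exact (walkJoined_of_mem_endComponent hf (hN _ (le_max_right M N)) hv).mono
    fun x hx hxT => h x hxT hx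

theorem cutSeparates_iff (hf : IsRay G f) {T S : Finset V} :
    CutSeparates G T S f ↔ ∀ s ∈ S, s ∉ endComponent G f T := by
  constructor
  · rintro ⟨N, -, hN⟩ s hs ⟨n, hn, h⟩
    exact hN _ (le_max_left N n) s hs
      ((hf.walkJoined (le_max_right N n) fun i hi _ => hn i hi).symm.trans h)
  · intro h
    obtain ⟨N, hN⟩ := hf.eventually_notMem T.finite_toSet
    exact ⟨N, hN, fun n hn s hs hw => h s hs ⟨n, fun m hm => hN m (hn.trans hm), hw⟩⟩

/-- No set smaller than `A` separates `A` from the end of `f`. -/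
def EndTight (G : SimpleGraph V) (f : ℕ → V) (A : Finset V) : Prop :=
  ∀ T : Finset V, (∀ a ∈ A, a ∉ endComponent G f T) → A.card ≤ T.card

/-- A minimum-size separator of `S` from the end of `f`: it is tight, and each of its vertices
has a neighbour in the component of the end. -/
theorem exists_endTight_separator (hf : IsRay G f) (S : Finset V) :
    ∃ A : Finset V, (∀ s ∈ S, s ∉ endComponent G f A) ∧ EndTight G f A ∧
      ∀ a ∈ A, ∃ x ∈ endComponent G f A, G.Adj x a := by
  classical
  have hex : ∃ n, ∃ A : Finset V, A.card = n ∧ ∀ s ∈ S, s ∉ endComponent G f A :=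
    ⟨_, S, rfl, fun s hs h => notMem_of_mem_endComponent h hs⟩
  obtain ⟨A, hcard, hA⟩ := Nat.find_spec hex
  have hmin : ∀ T : Finset V, (∀ s ∈ S, s ∉ endComponent G f T) → A.card ≤ T.card :=
    fun T hT => hcard.le.trans (Nat.find_min' hex ⟨T, rfl, hT⟩)
  refine ⟨A, hA, fun T hT => hmin T fun s hs h => hA s hs (endComponent_subset hf hT h), ?_⟩
  intro a ha
  have hlt := Finset.card_erase_lt_of_mem ha
  obtain ⟨s, hs, hsC⟩ : ∃ s ∈ S, s ∈ endComponent G f (A.erase a) := by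
    by_contra! h
    exact absurd (hmin _ h) (by omega)
  obtain ⟨M, hM⟩ := hf.eventually_mem_endComponent A
  obtain ⟨N, hN⟩ := hf.eventually_mem_endComponent (A.erase a)
  obtain ⟨x, hx, y, hy, hxy, -, hyC⟩ :=
    (walkJoined_of_mem_endComponent hf (hN _ (le_max_right M N)) hsC).exists_adj_of_mem_of_notMem
      (hM _ (le_max_left M N)) (hA s hs)
  refine ⟨x, hx, ?_⟩
  have hya : y = a := by
    by_contra hne
    have h1 := notMem_of_mem_endComponent hyC
    exact hy (endComponent_of_adj hx hxy fun h => h1 (Finset.mem_erase.2 ⟨hne, h⟩))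
  rwa [← hya]

/-- A Menger-type linkage of `A` into `B` inside a finite set `K`, encoded as an injection moving
each vertex to itself or to a neighbour. -/
theorem exists_linkage (A B K : Finset V)
    (h : ∀ T : Finset V, T.card < A.card →
      ∃ a ∈ A, ∃ b ∈ B, WalkJoined G {x | x ∈ K ∧ x ∉ T} a b) :
    ∃ σ : V → V, Set.InjOn σ {x | x ∈ K ∧ x ∉ B} ∧
      ∀ v ∈ K, v ∉ B → (σ v ∈ K ∧ σ v ∉ A) ∧ (σ v = v ∨ G.Adj v (σ v)) := by
  classical
  let t : {x // x ∈ K ∧ x ∉ B} → Finset V := fun v =>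
    {w ∈ K | w ∉ A ∧ (w = v ∨ G.Adj v w)}
  have hall : ∀ s : Finset {x // x ∈ K ∧ x ∉ B}, s.card ≤ (s.biUnion t).card := by
    intro s
    by_contra! hlt
    let X : Finset V := s.map (Function.Embedding.subtype _)
    have hXc : X.card = s.card := Finset.card_map _
    have hX : ∀ x ∈ X, x ∈ K ∧ x ∉ B := by
      intro x hx
      obtain ⟨y, -, rfl⟩ := Finset.mem_map.1 hx
      exact y.2
    let N : Finset V := {w ∈ K | ∃ v ∈ X, w = v ∨ G.Adj v w}
    have hXN : X ⊆ N := fun x hx => Finset.mem_filter.2 ⟨(hX x hx).1, x, hx, .inl rfl⟩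
    have hNt : N \ A ⊆ s.biUnion t := by
      intro w hw
      obtain ⟨hwN, hwA⟩ := Finset.mem_sdiff.1 hw
      obtain ⟨hwK, v, hv, hvw⟩ := Finset.mem_filter.1 hwN
      obtain ⟨y, hy, rfl⟩ := Finset.mem_map.1 hv
      exact Finset.mem_biUnion.2 ⟨y, hy, Finset.mem_filter.2 ⟨hwK, hwA, hvw⟩⟩
    have h1 := Finset.card_le_card hNt
    have h2 : (N \ A).card + A.card = (N ∪ A).card := Finset.card_sdiff_add_card N A
    have h3 : ((N ∪ A) \ X).card + X.card = (N ∪ A).card :=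
      Finset.card_sdiff_add_card_eq_card (hXN.trans Finset.subset_union_left)
    obtain ⟨a, ha, b, hb, hab⟩ := h ((N ∪ A) \ X) (by omega)
    have haX : a ∈ X := by
      by_contra haX
      exact hab.left_mem.2 (Finset.mem_sdiff.2 ⟨Finset.mem_union_right _ ha, haX⟩)
    obtain ⟨x, hx, y, hy, hxy, -, hyK, hyT⟩ :=
      hab.exists_adj_of_mem_of_notMem (X := (X : Set V)) haX fun hbX => (hX b hbX).2 hb
    exact hyT (Finset.mem_sdiff.2 ⟨Finset.mem_union_left _
      (Finset.mem_filter.2 ⟨hyK, x, hx, .inr hxy⟩), hy⟩)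
  obtain ⟨τ, hτ, hτt⟩ := (Finset.all_card_le_biUnion_card_iff_exists_injective t).1 hall
  refine ⟨fun v => if hv : v ∈ K ∧ v ∉ B then τ ⟨v, hv⟩ else v, ?_, ?_⟩
  · intro x hx y hy hxy
    have hx' : x ∈ K ∧ x ∉ B := hx
    have hy' : y ∈ K ∧ y ∉ B := hy
    simp only [dif_pos hx', dif_pos hy'] at hxy
    exact congrArg Subtype.val (hτ hxy)
  · intro v hv hvB
    have := Finset.mem_filter.1 (hτt ⟨v, hv, hvB⟩)
    simp only [dif_pos (And.intro hv hvB)]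
    exact ⟨⟨this.1, this.2.1⟩, this.2.2⟩

/-- If no fewer than `k` vertices separate `A` from `B` inside `R`, then this is already so
inside some finite subset of `R`. -/
theorem exists_finset_walkJoined (A B : Finset V) (R : Set V) (k : ℕ)
    (h : ∀ T : Finset V, T.card < k →
      ∃ a ∈ A, ∃ b ∈ B, WalkJoined G {x | x ∈ R ∧ x ∉ T} a b) :
    ∃ K : Finset V, ∀ T : Finset V, T.card < k →
      ∃ a ∈ A, ∃ b ∈ B, WalkJoined G {x | (x ∈ K ∧ x ∈ R) ∧ x ∉ T} a b := by
  classical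
  by_contra! hcon
  choose T hTk hT using hcon
  let U : Ultrafilter (Finset V) := Ultrafilter.of Filter.atTop
  have hU : (U : Filter (Finset V)) ≤ Filter.atTop := Ultrafilter.of_le _
  let X : Set V := {v | ∀ᶠ K in (U : Filter (Finset V)), v ∈ T K}
  have hX : ∀ Y : Finset V, (Y : Set V) ⊆ X → Y.card < k := by
    intro Y hY
    have : ∀ᶠ K in (U : Filter (Finset V)), ∀ y ∈ Y, y ∈ T K :=
      (Filter.eventually_all_finset Y).2 fun y hy => hY hy
    obtain ⟨K, hK⟩ := this.exists
    exact (Finset.card_le_card hK).trans_lt (hTk K)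
  have hfin : X.Finite := by
    by_contra hinf
    obtain ⟨Y, hY, hYk⟩ := Set.Infinite.exists_subset_card_eq hinf k
    exact absurd (hX Y hY) (by omega)
  obtain ⟨a, ha, b, hb, p, hp⟩ := h hfin.toFinset (hX _ (by simp))
  have hev : ∀ᶠ K in (U : Filter (Finset V)), ∀ x ∈ p.support.toFinset, x ∈ K ∧ x ∉ T K := by
    refine (Filter.eventually_all_finset _).2 fun x hx => ?_
    have h1 : ∀ᶠ K in (U : Filter (Finset V)), x ∈ K :=
      hU ((Filter.eventually_ge_atTop {x}).mono fun K hK => hK (Finset.mem_singleton_self x))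
    have h2 : ∀ᶠ K in (U : Filter (Finset V)), x ∉ T K := by
      rw [Ultrafilter.eventually_not]
      intro hxX
      exact (hp x (List.mem_toFinset.1 hx)).2 (hfin.mem_toFinset.2 hxX)
    exact h1.and h2
  obtain ⟨K, hK⟩ := hev.exists
  refine hT K a ha b hb ⟨p, fun x hx => ?_⟩
  have := hK x (List.mem_toFinset.2 hx)
  exact ⟨⟨this.1, (hp x hx).1⟩, this.2⟩

/-- A tight set is linked, through a finite set, to another tight set further towards the end. -/
theorem EndTight.exists_next (hlf : ∀ x : V, (G.neighborSet x).Finite) (hf : IsRay G f)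
    {A : Finset V} (hA : EndTight G f A) :
    ∃ (A' K : Finset V) (σ : V → V), EndTight G f A' ∧
      (∀ v ∈ A', v ∈ endComponent G f A) ∧
      endComponent G f A' ⊆ endComponent G f A ∧
      (∀ v ∈ A, v ∈ K) ∧
      (∀ v ∈ K, (v ∈ A ∨ v ∈ endComponent G f A) ∧ v ∉ endComponent G f A') ∧
      Set.InjOn σ {x | x ∈ K ∧ x ∉ A'} ∧
      ∀ v ∈ K, v ∉ A' → (σ v ∈ K ∧ σ v ∉ A) ∧ (σ v = v ∨ G.Adj v (σ v)) := by
  classical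
  obtain ⟨A', hsep, htight, hnbr⟩ :=
    exists_endTight_separator hf (A ∪ A.biUnion fun a => (hlf a).toFinset)
  have hsepA : ∀ a ∈ A, a ∉ endComponent G f A' :=
    fun a ha => hsep a (Finset.mem_union_left _ ha)
  have hsub : endComponent G f A' ⊆ endComponent G f A := endComponent_subset hf hsepA
  have hA' : ∀ v ∈ A', v ∈ endComponent G f A := by
    intro v hv
    obtain ⟨x, hx, hxv⟩ := hnbr v hv
    refine endComponent_of_adj (hsub hx) hxv fun hvA => hsep x ?_ hx
    exact Finset.mem_union_right _ (Finset.mem_biUnion.2 ⟨v, hvA, by simpa using hxv.symm⟩)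
  let R : Set V := {x | (x ∈ A ∨ x ∈ endComponent G f A) ∧ x ∉ endComponent G f A'}
  have hR : ∀ T : Finset V, T.card < A.card →
      ∃ a ∈ A, ∃ b ∈ A', WalkJoined G {x | x ∈ R ∧ x ∉ T} a b := by
    intro T hT
    by_contra! hno
    obtain ⟨a, ha, haT⟩ : ∃ a ∈ A, a ∈ endComponent G f T := by
      by_contra! h
      exact absurd (hA T h) (by omega)
    obtain ⟨M, hM⟩ := hf.eventually_mem_endComponent A'
    obtain ⟨N, hN⟩ := hf.eventually_mem_endComponent T
    have hMN := hM _ (le_max_left M N)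
    let Y : Set V := {v | ∃ a ∈ A, WalkJoined G {x | x ∈ R ∧ x ∉ T} a v}
    have hAY : ∀ y ∈ A, y ∉ T → y ∈ Y := fun y hy hyT =>
      ⟨y, hy, .refl ⟨⟨.inl hy, hsepA y hy⟩, hyT⟩⟩
    have hYR : ∀ y ∈ Y, y ∈ R ∧ y ∉ T := fun y ⟨_, _, h⟩ => h.symm.left_mem
    obtain ⟨x, hx, y, hy, hxy, -, hyT⟩ :=
      (walkJoined_of_mem_endComponent hf haT
        (hN _ (le_max_right M N))).exists_adj_of_mem_of_notMem
        (X := Y ∪ {x | ¬ (x ∈ A ∨ x ∈ endComponent G f A)})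
        (.inl (hAY a ha (notMem_of_mem_endComponent haT)))
        (by
          rintro (h | h)
          · exact (hYR _ h).1.2 hMN
          · exact h (.inr (hsub hMN)))
    have hyT' := notMem_of_mem_endComponent hyT
    have hyY : y ∉ Y := fun h => hy (.inl h)
    have hyD : y ∈ A ∨ y ∈ endComponent G f A := by
      by_contra h
      exact hy (.inr h)
    rcases hx with hx | hx
    · by_cases hyC : y ∈ endComponent G f A'
      · have hxA' : x ∈ A' := by
          by_contra hxA'
          exact (hYR x hx).1.2 (endComponent_of_adj hyC hxy.symm hxA')
        obtain ⟨c, hc, hcx⟩ := hx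
        exact hno c hc x hxA' hcx
      · obtain ⟨c, hc, hcx⟩ := hx
        exact hyY ⟨c, hc, hcx.trans (.of_adj hxy hcx.symm.left_mem ⟨⟨hyD, hyC⟩, hyT'⟩)⟩
    · rcases hyD with hyA | hyC
      · exact hyY (hAY y hyA hyT')
      · refine hx (.inr (endComponent_of_adj hyC hxy.symm fun hxA => hx (.inl hxA)))
  obtain ⟨K, hK⟩ := exists_finset_walkJoined A A' R A.card hR
  let L : Finset V := A ∪ {x ∈ K | x ∈ R}
  obtain ⟨σ, hinj, hσ⟩ := exists_linkage (G := G) A A' L fun T hT => by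
    obtain ⟨a, ha, b, hb, hab⟩ := hK T hT
    refine ⟨a, ha, b, hb, hab.mono fun x hx => ⟨?_, hx.2⟩⟩
    exact Finset.mem_union_right _ (Finset.mem_filter.2 hx.1)
  refine ⟨A', L, σ, htight, hA', hsub, fun v hv => Finset.mem_union_left _ hv, ?_, hinj, hσ⟩
  intro v hv
  rcases Finset.mem_union.1 hv with hv | hv
  · exact ⟨.inl hv, hsepA v hv⟩
  · exact (Finset.mem_filter.1 hv).2

theorem HasVDisjointRays.mono {m n : ℕ} (h : HasVDisjointRays G f n) (hmn : m ≤ n) :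
    HasVDisjointRays G f m := by
  obtain ⟨F, h1, h2, h3⟩ := h
  refine ⟨fun i => F (Fin.castLE hmn i), fun i => h1 _, fun i => h2 _, fun i j hij => h3 ?_⟩
  exact fun h => hij (Fin.castLE_injective hmn h)

/-- Iterating an injection of `U` that avoids `A ⊆ U` and moves vertices along edges gives
disjoint rays starting in `A`. -/
theorem isRay_iterate {U : Set V} {A : Finset V} {σ : V → V} (hmaps : Set.MapsTo σ U U)
    (hinj : Set.InjOn σ U) (hAU : ∀ a ∈ A, a ∈ U) (hA : ∀ v ∈ U, σ v ∉ A)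
    (hadj : ∀ v ∈ U, σ v = v ∨ G.Adj v (σ v)) :
    (∀ a ∈ A, IsRay G fun n => σ^[n] a) ∧
      ∀ a ∈ A, ∀ b ∈ A, a ≠ b →
        Disjoint (Set.range fun n => σ^[n] a) (Set.range fun n => σ^[n] b) := by
  have hmem : ∀ a ∈ A, ∀ n, σ^[n] a ∈ U := fun a ha n => hmaps.iterate n (hAU a ha)
  have key : ∀ m n, ∀ a ∈ A, ∀ b ∈ A, σ^[m] a = σ^[n] b → m = n ∧ a = b := by
    intro m
    induction m with
    | zero =>
      intro n a ha b hb h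
      cases n with
      | zero => exact ⟨rfl, h⟩
      | succ n =>
        rw [Function.iterate_succ_apply'] at h
        exact absurd (h ▸ ha : σ (σ^[n] b) ∈ A) (hA _ (hmem b hb n))
    | succ m ih =>
      intro n a ha b hb h
      cases n with
      | zero =>
        rw [Function.iterate_succ_apply'] at h
        exact absurd (h.symm ▸ hb : σ (σ^[m] a) ∈ A) (hA _ (hmem a ha m))
      | succ n =>
        rw [Function.iterate_succ_apply', Function.iterate_succ_apply'] at h
        obtain ⟨h1, h2⟩ := ih n a ha b hb (hinj (hmem a ha m) (hmem b hb n) h)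
        exact ⟨by omega, h2⟩
  refine ⟨fun a ha => ⟨fun m n h => (key m n a ha a ha h).1, fun n => ?_⟩, ?_⟩
  · simp only [Function.iterate_succ_apply']
    refine (hadj _ (hmem a ha n)).resolve_left fun h => ?_
    rw [← Function.iterate_succ_apply' σ n a] at h
    have := (key _ _ a ha a ha h).1
    omega
  · intro a ha b hb hab
    rw [Set.disjoint_left]
    rintro _ ⟨m, rfl⟩ ⟨n, hn⟩
    exact hab (key n m b hb a ha hn).2.symm

theorem EndTight.hasVDisjointRays (hlf : ∀ x : V, (G.neighborSet x).Finite) (hf : IsRay G f)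
    {A₀ : Finset V} (hA₀ : EndTight G f A₀) : HasVDisjointRays G f A₀.card := by
  classical
  rcases A₀.eq_empty_or_nonempty with rfl | hne
  · exact ⟨fun i => i.elim0, fun i => i.elim0, fun i => i.elim0, fun i => i.elim0⟩
  choose next K₀ σ₀ hnext using
    fun A : {A : Finset V // EndTight G f A} => A.2.exists_next hlf hf
  let B : ℕ → {A : Finset V // EndTight G f A} := fun n =>
    Nat.rec ⟨A₀, hA₀⟩ (fun _ A => ⟨next A, (hnext A).1⟩) n
  let A : ℕ → Finset V := fun n => (B n).1
  let C : ℕ → Set V := fun n => endComponent G f (A n)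
  let K : ℕ → Finset V := fun n => K₀ (B n)
  let τ : ℕ → V → V := fun n => σ₀ (B n)
  have hAC : ∀ n, ∀ v ∈ A (n + 1), v ∈ C n := fun n => (hnext (B n)).2.1
  have hCC : ∀ n, C (n + 1) ⊆ C n := fun n => (hnext (B n)).2.2.1
  have hAK : ∀ n, ∀ v ∈ A n, v ∈ K n := fun n => (hnext (B n)).2.2.2.1
  have hK : ∀ n, ∀ v ∈ K n, (v ∈ A n ∨ v ∈ C n) ∧ v ∉ C (n + 1) :=
    fun n => (hnext (B n)).2.2.2.2.1
  have hτinj : ∀ n, Set.InjOn (τ n) {x | x ∈ K n ∧ x ∉ A (n + 1)} :=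
    fun n => (hnext (B n)).2.2.2.2.2.1
  have hτ : ∀ n, ∀ v ∈ K n, v ∉ A (n + 1) →
      (τ n v ∈ K n ∧ τ n v ∉ A n) ∧ (τ n v = v ∨ G.Adj v (τ n v)) :=
    fun n => (hnext (B n)).2.2.2.2.2.2
  have hanti : Antitone C := antitone_nat_of_succ_le hCC
  have hnAC : ∀ n, ∀ v ∈ A n, v ∉ C n := fun n v hv h => notMem_of_mem_endComponent h hv
  have hlt : ∀ {m n}, m < n → ∀ v, v ∈ A n ∨ v ∈ C n → v ∈ C m := by
    intro m n hmn v hv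
    obtain ⟨n, rfl⟩ : ∃ j, n = j + 1 := ⟨n - 1, by omega⟩
    refine hanti (by omega : m ≤ n) ?_
    rcases hv with hv | hv
    exacts [hAC n v hv, hCC n hv]
  have hPuniq : ∀ m n v, v ∈ K m → v ∉ A (m + 1) → v ∈ K n → v ∉ A (n + 1) → m = n := by
    have aux : ∀ m n v, v ∈ K m → v ∉ A (m + 1) → v ∈ K n → v ∉ A (n + 1) → ¬ m < n := by
      intro m n v hm hm' hn hn' hmn
      rcases Nat.lt_or_ge (m + 1) n with h | h
      · exact (hK m v hm).2 (hlt h v (hK n v hn).1)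
      · obtain rfl : n = m + 1 := by omega
        rcases (hK (m + 1) v hn).1 with h | h
        exacts [hm' h, (hK m v hm).2 h]
    intro m n v hm hm' hn hn'
    have h1 := aux m n v hm hm' hn hn'
    have h2 := aux n m v hn hn' hm hm'
    omega
  have hQuniq : ∀ m n v, v ∈ K m → v ∉ A m → v ∈ K n → v ∉ A n → m = n := by
    have aux : ∀ m n v, v ∈ K m → v ∉ A m → v ∈ K n → v ∉ A n → ¬ m < n := by
      intro m n v hm hm' hn hn' hmn
      exact (hK m v hm).2 (hanti (show m + 1 ≤ n from hmn) ((hK n v hn).1.resolve_left hn'))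
    intro m n v hm hm' hn hn'
    have h1 := aux m n v hm hm' hn hn'
    have h2 := aux n m v hn hn' hm hm'
    omega
  let U : Set V := {v | ∃ n, v ∈ K n ∧ v ∉ A (n + 1)}
  let σ : V → V := fun v => if h : v ∈ U then τ h.choose v else v
  have hσ : ∀ n v, v ∈ K n → v ∉ A (n + 1) → σ v = τ n v := by
    intro n v hv hv'
    have hU : v ∈ U := ⟨n, hv, hv'⟩
    have : hU.choose = n := hPuniq _ _ v hU.choose_spec.1 hU.choose_spec.2 hv hv'
    simp only [σ, dif_pos hU, this]
  have hKU : ∀ n, ∀ v ∈ K n, v ∈ U := by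
    intro n v hv
    by_cases h : v ∈ A (n + 1)
    · exact ⟨n + 1, hAK (n + 1) v h, fun h' => hnAC (n + 1) v h (hAC (n + 1) v h')⟩
    · exact ⟨n, hv, h⟩
  have hmaps : Set.MapsTo σ U U := by
    rintro v ⟨n, hv, hv'⟩
    rw [hσ n v hv hv']
    exact hKU n _ (hτ n v hv hv').1.1
  have hinj : Set.InjOn σ U := by
    rintro v ⟨m, hv, hv'⟩ w ⟨n, hw, hw'⟩ h
    rw [hσ m v hv hv', hσ n w hw hw'] at h
    have h1 := (hτ m v hv hv').1
    have h2 := (hτ n w hw hw').1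
    obtain rfl : m = n := hQuniq m n _ h1.1 h1.2 (h ▸ h2.1) (h ▸ h2.2)
    exact hτinj m ⟨hv, hv'⟩ ⟨hw, hw'⟩ h
  have hσA : ∀ v ∈ U, σ v ∉ A 0 := by
    rintro v ⟨n, hv, hv'⟩ h
    have h1 := (hτ n v hv hv').1
    rw [hσ n v hv hv'] at h
    exact hnAC 0 _ h (hanti (Nat.zero_le n) ((hK n _ h1.1).1.resolve_left h1.2))
  have hσadj : ∀ v ∈ U, σ v = v ∨ G.Adj v (σ v) := by
    rintro v ⟨n, hv, hv'⟩
    rw [hσ n v hv hv']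
    exact (hτ n v hv hv').2
  have hAU : ∀ a ∈ A 0, a ∈ U := fun a ha => hKU 0 a (hAK 0 a ha)
  obtain ⟨hray, hdisj⟩ := isRay_iterate hmaps hinj hAU hσA hσadj
  have hleave : ∀ s, ∃ n, s ∉ C n := by
    intro s
    by_contra! hs
    obtain ⟨a, ha, haC⟩ : ∃ a ∈ A₀, a ∈ endComponent G f ∅ := by
      by_contra! h
      exact absurd (hA₀ ∅ h) (by simpa using hne.ne_empty)
    have hsC : s ∈ endComponent G f ∅ := endComponent_subset hf (by simp) (hs 0)
    obtain ⟨p, -⟩ := walkJoined_of_mem_endComponent hf hsC haC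
    have hmeet : ∀ n, ∃ v ∈ A n, v ∈ p.support := by
      intro n
      have hp : WalkJoined G {x | x ∈ p.support} s a := ⟨p, fun x hx => hx⟩
      obtain ⟨x, hx, y, hy, hxy, -, hyp⟩ := hp.exists_adj_of_mem_of_notMem (hs n)
        (fun h => hnAC 0 a ha (hanti (Nat.zero_le n) h))
      refine ⟨y, ?_, hyp⟩
      by_contra hyA
      exact hy (endComponent_of_adj hx hxy hyA)
    choose v hvA hvp using hmeet
    have hvinj : Function.Injective v := by
      have aux : ∀ m n, v m = v n → ¬ m < n := fun m n h hmn =>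
        hnAC m _ (hvA m) (h ▸ hlt hmn _ (.inl (hvA n)))
      intro m n h
      have h1 := aux m n h
      have h2 := aux n m h.symm
      omega
    exact Set.infinite_range_of_injective hvinj
      ((p.support.finite_toSet).subset (by rintro _ ⟨n, rfl⟩; exact hvp n))
  have havoid : ∀ S : Finset V, ∃ n, ∀ s ∈ S, s ∉ C n := by
    intro S
    choose n hn using hleave
    exact ⟨S.sup n, fun s hs h => hn s (hanti (Finset.le_sup hs) h)⟩
  have hequiv : ∀ a ∈ A 0, RayEquiv G (fun n => σ^[n] a) f := by
    intro a ha S m₀ n₀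
    obtain ⟨n, hn⟩ := havoid S
    have hfin : (((Finset.range (n + 1)).biUnion K : Finset V) : Set V).Finite :=
      Finset.finite_toSet _
    obtain ⟨M, hM⟩ := (hray a ha).eventually_notMem hfin
    obtain ⟨N, hN⟩ := hf.eventually_mem_endComponent (A n)
    have hmem : σ^[max m₀ M] a ∈ C n := by
      obtain ⟨j, hj, hj'⟩ := hmaps.iterate (max m₀ M) (hAU a ha)
      refine hlt (?_ : n < j) _ (hK j _ hj).1
      by_contra hnj
      exact hM _ (le_max_right m₀ M) (by
        simp only [Finset.coe_biUnion, Set.mem_iUnion]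
        exact ⟨j, by simp; omega, hj⟩)
    obtain ⟨p, hp⟩ := walkJoined_of_mem_endComponent hf hmem (hN _ (le_max_right n₀ N))
    exact ⟨_, _, le_max_left _ _, le_max_left _ _, p, fun x hx hxS => hn x hxS (hp x hx)⟩
  let e := A₀.equivFin.symm
  refine ⟨fun i n => σ^[n] (e i), fun i => hray _ (e i).2, fun i => hequiv _ (e i).2, ?_⟩
  intro i j hij
  exact hdisj _ (e i).2 _ (e j).2 fun h => hij (e.injective (Subtype.ext h))

theorem hasVDisjointRays_of_not_separated (hlf : ∀ x : V, (G.neighborSet x).Finite)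
    (hf : IsRay G f) {m : ℕ}
    (h : ¬ ∀ S : Finset V, ∃ T : Finset V, T.card = m ∧ CutSeparates G T S f) :
    HasVDisjointRays G f (m + 1) := by
  push Not at h
  obtain ⟨S, hS⟩ := h
  obtain ⟨A, hsep, htight, -⟩ := exists_endTight_separator hf S
  refine (htight.hasVDisjointRays hlf hf).mono ?_
  by_contra! hlt
  have : Infinite V := Infinite.of_injective f hf.1
  obtain ⟨T, hAT, hT⟩ := Infinite.exists_superset_card_eq A m (by omega)
  refine hS T hT ((cutSeparates_iff hf).2 fun s hs h => hsep s hs ?_)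
  exact endComponent_subset hf (fun x hx hxT => notMem_of_mem_endComponent hxT (hAT hx)) h

theorem HasVDisjointRays.le_of_separated (hf : IsRay G f) {k m : ℕ}
    (hk : HasVDisjointRays G f k)
    (h : ∀ S : Finset V, ∃ T : Finset V, T.card = m ∧ CutSeparates G T S f) : k ≤ m := by
  classical
  obtain ⟨F, hray, hequiv, hdisj⟩ := hk
  obtain ⟨T, rfl, hT⟩ := h (Finset.univ.image fun i => F i 0)
  rw [cutSeparates_iff hf] at hT
  have hmeet : ∀ i, ∃ n, F i n ∈ T := by
    intro i
    by_contra! hi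
    refine hT (F i 0) (Finset.mem_image_of_mem _ (Finset.mem_univ i)) ?_
    obtain ⟨N, hN⟩ := hf.eventually_mem_endComponent T
    obtain ⟨m, n, -, hn, w⟩ := hequiv i T 0 N
    have hw : WalkJoined G {x | x ∉ T} (F i m) (f n) := w
    exact endComponent_of_walkJoined (hN n hn)
      (hw.symm.trans ((hray i).walkJoined (Nat.zero_le m) fun j _ _ => hi j).symm)
  choose n hn using hmeet
  have hinj : Function.Injective fun i => F i (n i) := by
    intro i j hij
    by_contra hne
    exact Set.disjoint_left.1 (hdisj hne) ⟨n i, rfl⟩ ⟨n j, hij.symm⟩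
  simpa using Finset.card_le_card_of_injOn (s := Finset.univ) (t := T) _ (fun i _ => hn i)
    hinj.injOn

end EndSeparators

/-- In a locally finite graph, the vertex-degree of an end `ω` equals `k` iff `k` is the
least integer such that every finite vertex set can be separated from `ω` by a separator
of size `k`. -/
theorem stmt10 {V : Type u} (G : SimpleGraph V) (k : ℕ)
    (hlf : ∀ x : V, (G.neighborSet x).Finite) (f : ℕ → V) (hf : IsRay G f) :
    (HasVDisjointRays G f k ∧ ¬ HasVDisjointRays G f (k + 1)) ↔
      IsLeast {m : ℕ | ∀ S : Finset V, ∃ T : Finset V,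
        T.card = m ∧ CutSeparates G T S f} k := by
  constructor
  · rintro ⟨hk, hk'⟩
    refine ⟨?_, fun m hm => hk.le_of_separated hf hm⟩
    by_contra h
    exact hk' (hasVDisjointRays_of_not_separated hlf hf h)
  · rintro ⟨hk, hmin⟩
    refine ⟨?_, fun h => absurd (h.le_of_separated hf hk) (by omega)⟩
    cases k with
    | zero => exact ⟨fun i => i.elim0, fun i => i.elim0, fun i => i.elim0, fun i => i.elim0⟩
    | succ j =>
      refine hasVDisjointRays_of_not_separated hlf hf fun h => ?_
      exact absurd (hmin h) (by omega)
end

section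
/- Let k ≥ 2 and let G be an infinite locally finite edge-minimally k-connected graph. Then G has infinitely many vertices of degree k. -/
open SimpleGraph Cardinal

universe u v

variable {V : Type u}

/-- In a `k`-connected graph, a finite set separating two nonempty sets has at least `k` elements. -/
lemma KConnected.le_ncard_of_separates {G : SimpleGraph V} {k : ℕ} (h : KConnected G k)
    {P S : Set V} (hS : S.Finite) {p q : V} (hp : p ∈ P) (hpS : p ∉ S) (hq : q ∉ P) (hqS : q ∉ S)
    (hadj : ∀ u ∈ P, ∀ v, G.Adj u v → v ∈ P ∨ v ∈ S) : k ≤ S.ncard := by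
  by_contra! hlt
  have hcard : hS.toFinset.card < k := by rwa [← Set.ncard_eq_toFinset_card S hS]
  obtain ⟨w⟩ := (h.2 hS.toFinset hcard).preconnected ⟨p, by simpa using hpS⟩ ⟨q, by simpa using hqS⟩
  obtain ⟨d, -, hd, hd'⟩ := w.exists_boundary_dart {v | (v : V) ∈ P} hp hq
  have hnot : (d.snd : V) ∉ S := by simpa using d.snd.2
  exact (hadj _ hd _ d.adj).elim hd' hnot

/-- A vertex set `P` together with fewer than `k` further vertices `S` such that `xy` is the only
edge from `P` to the complement of `P ∪ S`. -/
structure IsEdgeSeparation (G : SimpleGraph V) (k : ℕ) (x y : V) (P S : Set V) : Prop where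
  finite : S.Finite
  ncard_lt : S.ncard < k
  disjoint : Disjoint P S
  left_mem : x ∈ P
  right_notMem : y ∉ P
  right_notMem' : y ∉ S
  eq_of_adj : ∀ u ∈ P, ∀ v, v ∉ P → v ∉ S → G.Adj u v → u = x ∧ v = y

lemma EdgeMinKConnected.exists_isEdgeSeparation [Infinite V] {G : SimpleGraph V} {k : ℕ}
    (h : EdgeMinKConnected G k) {x y : V} (hxy : G.Adj x y) :
    ∃ P S : Set V, IsEdgeSeparation G k x y P S := by
  have hnot := h.2 s(x, y) hxy
  simp only [KConnected, not_and, not_forall] at hnot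
  obtain ⟨S, hSk, hS⟩ := hnot h.1.1
  have hne : Nonempty ↥((S : Set V)ᶜ) := (h.1.2 S hSk).nonempty
  have hpre : ¬ ((G.deleteEdges {s(x, y)}).induce ((S : Set V)ᶜ)).Preconnected :=
    fun hc => hS ⟨hc⟩
  simp only [Preconnected, not_forall] at hpre
  obtain ⟨a, b, hab⟩ := hpre
  set P : Set V := {v | ∃ hv : v ∈ (S : Set V)ᶜ,
    ((G.deleteEdges {s(x, y)}).induce ((S : Set V)ᶜ)).Reachable a ⟨v, hv⟩} with hP
  have haP : (a : V) ∈ P := ⟨a.2, Reachable.refl _⟩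
  have hbP : (b : V) ∉ P := fun ⟨_, hv⟩ => hab hv
  have hPS : ∀ v ∈ P, v ∉ S := fun v ⟨hv, _⟩ => by simpa using hv
  have hclosed : ∀ u ∈ P, ∀ v, v ∉ P → v ∉ S → G.Adj u v → s(u, v) = s(x, y) := by
    rintro u ⟨hu, hau⟩ v hvP hvS huv
    by_contra hne
    refine hvP ⟨by simpa using hvS, hau.trans (Adj.reachable ?_)⟩
    simpa [huv] using hne
  have hcross : ∃ u ∈ P, ∃ v, v ∉ P ∧ v ∉ S ∧ G.Adj u v := by
    by_contra! hno
    have := h.1.le_ncard_of_separates S.finite_toSet haP a.2 hbP b.2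
      (fun u hu v huv => by
        by_contra! hv
        exact hno u hu v hv.1 (by simpa using hv.2) huv)
    rw [Set.ncard_coe_finset] at this
    lia
  obtain ⟨u, hu, v, hv, hvS, huv⟩ := hcross
  have hScard : (S : Set V).ncard < k := by rwa [Set.ncard_coe_finset]
  have huS := hPS u hu
  rcases Sym2.eq_iff.1 (hclosed u hu v hv hvS huv) with ⟨rfl, rfl⟩ | ⟨rfl, rfl⟩
  · refine ⟨P, S, S.finite_toSet, hScard, Set.disjoint_left.2 hPS, hu, hv, hvS, ?_⟩
    intro p hp q hq hqS hpq
    rcases Sym2.eq_iff.1 (hclosed p hp q hq hqS hpq) with h | ⟨rfl, rfl⟩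
    · exact h
    · exact absurd hp hv
  · refine ⟨(P ∪ S)ᶜ, S, S.finite_toSet, hScard, ?_, ?_, ?_, huS, ?_⟩
    · exact Set.disjoint_left.2 fun p hp hpS => hp (Or.inr hpS)
    · simp [hv, hvS]
    · simp [hu]
    · intro p hp q hq hqS hpq
      have hqP : q ∈ P := by
        by_contra hc
        exact hq fun h' => h'.elim hc hqS
      have hp' : p ∉ P ∧ p ∉ S := by simpa using hp
      rcases Sym2.eq_iff.1 (hclosed q hqP p hp'.1 hp'.2 hpq.symm) with ⟨rfl, rfl⟩ | ⟨rfl, rfl⟩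
      · exact absurd hqP hv
      · exact ⟨rfl, rfl⟩

lemma Set.Finite.ncard_eq_add_of_partition {T A B : Set V} (hT : T.Finite) (hAB : Disjoint A B) :
    T.ncard = (T ∩ A).ncard + (T ∩ B).ncard + (T ∩ (A ∪ B)ᶜ).ncard := by
  rw [← Set.ncard_union_eq (hAB.mono Set.inter_subset_right Set.inter_subset_right)
    (hT.inter_of_left _) (hT.inter_of_left _), ← Set.inter_union_distrib_left,
    ← Set.sdiff_eq, Set.ncard_inter_add_ncard_sdiff_eq_ncard _ _ hT]

/-- Two separations of consecutive edges at a vertex of degree greater than `k`. -/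
lemma IsEdgeSeparation.encard_diff_lt {G : SimpleGraph V} {k : ℕ} (hG : KConnected G k)
    {x y z : V} {Q S R T : Set V} (hQ : IsEdgeSeparation G k y x Q S)
    (hR : IsEdgeSeparation G k x z R T) (hlf : (G.neighborSet x).Finite)
    (hdeg : k < (G.neighborSet x).ncard) (hyx : G.Adj y x) (hxz : G.Adj x z) (hyz : y ≠ z) :
    (Q \ R).encard < (R \ Q).encard := by
  obtain ⟨hSf, hSk, hQS, hyQ, hxQ, hxS, hQadj⟩ := hQ
  obtain ⟨hTf, hTk, hRT, hxR, hzR, hzT, hRadj⟩ := hR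
  have hS3 := hSf.ncard_eq_add_of_partition hRT
  have hT3 := hTf.ncard_eq_add_of_partition hQS
  rw [Set.inter_comm T S] at hT3
  rw [Set.disjoint_left] at hQS hRT
  set C : Set V := (S ∩ R) ∪ (S ∩ T) ∪ (T ∩ (Q ∪ S)ᶜ) with hC
  have hCf : C.Finite :=
    ((hSf.inter_of_left _).union (hSf.inter_of_left _)).union (hTf.inter_of_left _)
  have hCle : C.ncard ≤ (S ∩ R).ncard + (S ∩ T).ncard + (T ∩ (Q ∪ S)ᶜ).ncard :=
    (Set.ncard_union_le _ _).trans (by gcongr; exact Set.ncard_union_le _ _)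
  -- Adjacencies of the corner `(Q ∪ S)ᶜ ∩ R` containing `x`.
  have hcorner : ∀ u, u ∉ Q → u ∉ S → u ∈ R → ∀ v, G.Adj u v →
      (v ∉ Q ∧ v ∉ S ∧ v ∈ R) ∨ v ∈ C ∨ (u = x ∧ (v = y ∨ v = z)) := by
    intro u huQ huS huR v huv
    have h1 : v ∈ Q → v = y ∧ u = x := fun hv => hQadj v hv u huQ huS huv.symm
    have h2 : v ∉ R → v ∉ T → u = x ∧ v = z := fun hv hv' => hRadj u huR v hv hv' huv
    simp only [hC, Set.mem_union, Set.mem_inter_iff, Set.mem_compl_iff]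
    tauto
  have hCk : k ≤ C.ncard + 1 := by
    by_cases hsing : ∃ p, p ∉ Q ∧ p ∉ S ∧ p ∈ R ∧ p ≠ x
    · obtain ⟨p, hpQ, hpS, hpR, hpx⟩ := hsing
      have hsep := hG.le_ncard_of_separates (P := {u | u ∉ Q ∧ u ∉ S ∧ u ∈ R ∧ u ≠ x})
        (S := insert x C) (hCf.insert x) (p := p) (q := y) ⟨hpQ, hpS, hpR, hpx⟩
        (by
          have := @hRT p
          simp only [hC, Set.mem_insert_iff, Set.mem_union, Set.mem_inter_iff, Set.mem_compl_iff]
          tauto)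
        (fun h => h.1 hyQ)
        (by
          have := @hQS y
          have := hyx.ne
          simp only [hC, Set.mem_insert_iff, Set.mem_union, Set.mem_inter_iff, Set.mem_compl_iff]
          tauto)
        (by
          rintro u ⟨huQ, huS, huR, hux⟩ v huv
          have := hcorner u huQ huS huR v huv
          simp only [Set.mem_ofPred_eq, Set.mem_insert_iff]
          tauto)
      exact hsep.trans (Set.ncard_insert_le _ _)
    · push Not at hsing
      have hsub : G.neighborSet x ⊆ insert y (insert z C) := by
        intro v hv
        have hv : G.Adj x v := hv
        have := hcorner x hxQ hxS hxR v hv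
        have := hsing v
        have := hv.ne'
        simp only [Set.mem_insert_iff]
        tauto
      have h1 := Set.ncard_le_ncard hsub ((hCf.insert z).insert y)
      have h2 := Set.ncard_insert_le y (insert z C)
      have h3 := Set.ncard_insert_le z C
      lia
  have hQW : ∀ q ∈ Q, q ∈ R ∨ q ∈ T := by
    by_contra! ⟨q, hqQ, hqR, hqT⟩
    have hsep := hG.le_ncard_of_separates (P := {u | u ∈ Q ∧ u ∉ R ∧ u ∉ T})
      (S := (S ∩ (R ∪ T)ᶜ) ∪ (S ∩ T) ∪ (T ∩ Q))
      (((hSf.inter_of_left _).union (hSf.inter_of_left _)).union (hTf.inter_of_left _))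
      (p := q) (q := x) ⟨hqQ, hqR, hqT⟩
      (by
        have := @hQS q
        simp only [Set.mem_union, Set.mem_inter_iff, Set.mem_compl_iff]
        tauto)
      (fun h => hxQ h.1)
      (by
        simp only [Set.mem_union, Set.mem_inter_iff, Set.mem_compl_iff]
        tauto)
      (by
        rintro u ⟨huQ, huR, huT⟩ v huv
        have hvR : v ∉ R := by
          intro hv
          obtain ⟨rfl, rfl⟩ := hRadj v hv u huR huT huv.symm
          exact hyz (hQadj u huQ v hxQ hxS huv).1.symm
        have hvQS : v ∈ Q ∨ v ∈ S := by
          by_contra! hv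
          exact hvR ((hQadj u huQ v hv.1 hv.2 huv).2 ▸ hxR)
        simp only [Set.mem_union, Set.mem_inter_iff, Set.mem_compl_iff, Set.mem_ofPred_eq]
        tauto)
    have h1 := Set.ncard_union_le (S ∩ (R ∪ T)ᶜ ∪ S ∩ T) (T ∩ Q)
    have h2 := Set.ncard_union_le (S ∩ (R ∪ T)ᶜ) (S ∩ T)
    lia
  have hle : (T ∩ Q).ncard < (insert x (S ∩ R)).ncard := by
    rw [Set.ncard_insert_of_notMem (fun h => hxS h.1) (hSf.inter_of_left _)]
    lia
  have hQR : Q \ R ⊆ T ∩ Q := fun q hq => ⟨(hQW q hq.1).resolve_left hq.2, hq.1⟩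
  have hRQ : insert x (S ∩ R) ⊆ R \ Q := by
    rintro v (rfl | hv)
    · exact ⟨hxR, hxQ⟩
    · exact ⟨hv.2, fun hvQ => hQS hvQ hv.1⟩
  calc (Q \ R).encard ≤ (T ∩ Q).encard := Set.encard_le_encard hQR
    _ = (T ∩ Q).ncard := ((hTf.inter_of_left _).cast_ncard_eq).symm
    _ < (insert x (S ∩ R)).ncard := by exact_mod_cast hle
    _ = (insert x (S ∩ R)).encard := ((hSf.inter_of_left _).insert x).cast_ncard_eq
    _ ≤ (R \ Q).encard := Set.encard_le_encard hRQ

/-- The relation `|A \ B| < |B \ A|` on sets has no directed cycles. -/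
lemma ne_of_encard_diff_lt {α : Type*} {A : ℕ → Set α}
    (hA : ∀ i, (A i \ A (i + 1)).encard < (A (i + 1) \ A i).encard) {n : ℕ} (hn : 0 < n) :
    A n ≠ A 0 := by
  intro hper
  have hfin : ∀ i, (A i \ A (i + 1)).Finite := fun i =>
    Set.encard_lt_top_iff.1 ((hA i).trans_le le_top)
  have hmono : ∀ i j, i ≤ j → (A i \ A j).Finite := by
    intro i j hij
    induction j, hij using Nat.le_induction with
    | base => simp
    | succ j _ ih =>
      refine (ih.union (hfin j)).subset fun v hv => ?_
      by_cases h : v ∈ A j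
      · exact Or.inr ⟨h, hv.2⟩
      · exact Or.inl ⟨hv.1, h⟩
  set F : Set α := ⋃ i ∈ Set.Iio n, (A i \ A (i + 1)) ∪ (A (i + 1) \ A i) with hF
  have hFf : F.Finite := by
    refine (Set.finite_Iio n).biUnion fun i hi => (hfin i).union ?_
    have h0 := hmono 0 i (Nat.zero_le _)
    have h1 := hmono (i + 1) n hi
    rw [hper] at h1
    refine (h1.union h0).subset fun v hv => ?_
    by_cases h : v ∈ A 0
    · exact Or.inr ⟨h, hv.2⟩
    · exact Or.inl ⟨hv.1, h⟩
  have hstep : ∀ i < n, (A i ∩ F).ncard < (A (i + 1) ∩ F).ncard := by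
    intro i hi
    have hi1 : A i \ A (i + 1) ⊆ F := fun v hv => Set.mem_biUnion (Set.mem_Iio.2 hi) (Or.inl hv)
    have hi2 : A (i + 1) \ A i ⊆ F := fun v hv => Set.mem_biUnion (Set.mem_Iio.2 hi) (Or.inr hv)
    have hlt := hA i
    rw [← (hFf.subset hi1).cast_ncard_eq, ← (hFf.subset hi2).cast_ncard_eq, Nat.cast_lt] at hlt
    have e1 := Set.ncard_inter_add_ncard_sdiff_eq_ncard (A i ∩ F) (A (i + 1)) (hFf.inter_of_right _)
    have e2 := Set.ncard_inter_add_ncard_sdiff_eq_ncard (A (i + 1) ∩ F) (A i) (hFf.inter_of_right _)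
    have d1 : (A i ∩ F) \ A (i + 1) = A i \ A (i + 1) := by
      ext v; have := @hi1 v; simp only [Set.mem_sdiff, Set.mem_inter_iff] at *; tauto
    have d2 : (A (i + 1) ∩ F) \ A i = A (i + 1) \ A i := by
      ext v; have := @hi2 v; simp only [Set.mem_sdiff, Set.mem_inter_iff] at *; tauto
    have d3 : (A (i + 1) ∩ F) ∩ A i = (A i ∩ F) ∩ A (i + 1) := by
      ext v; simp only [Set.mem_inter_iff]; tauto
    rw [d1] at e1
    rw [d2, d3] at e2
    lia
  have hinc : ∀ i ≤ n, (A 0 ∩ F).ncard + i ≤ (A i ∩ F).ncard := by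
    intro i
    induction i with
    | zero => simp
    | succ i ih => intro hi; have := ih (by lia); have := hstep i (by lia); lia
  have := hinc n le_rfl
  rw [hper] at this
  lia

/-- In an edge-minimally `k`-connected graph, every closed walk without immediate reversals
contains a vertex of degree at most `k`. -/
lemma EdgeMinKConnected.exists_ncard_neighborSet_le [Infinite V] {G : SimpleGraph V} {k : ℕ}
    (h : EdgeMinKConnected G k) (hlf : ∀ x : V, (G.neighborSet x).Finite) {f : ℕ → V} {n : ℕ}
    (hn : 0 < n) (hper : ∀ i, f (i + n) = f i) (hadj : ∀ i, G.Adj (f i) (f (i + 1)))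
    (hne : ∀ i, f i ≠ f (i + 2)) : ∃ i, (G.neighborSet (f i)).ncard ≤ k := by
  by_contra! hdeg
  choose! P S hPS using fun x y (hxy : G.Adj x y) => h.exists_isEdgeSeparation hxy
  refine ne_of_encard_diff_lt (A := fun i => P (f i) (f (i + 1))) (fun i => ?_) hn ?_
  · exact (hPS _ _ (hadj i)).encard_diff_lt h.1 (hPS _ _ (hadj (i + 1))) (hlf _) (hdeg _)
      (hadj i) (hadj (i + 1)) (hne i)
  · have h0 := hper 0
    have h1 := hper 1
    simp only [Nat.zero_add] at h0 ⊢
    rw [h0, Nat.add_comm, h1]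

lemma EdgeMinKConnected.isAcyclic_induce [Infinite V] {G : SimpleGraph V} {k : ℕ}
    (h : EdgeMinKConnected G k) (hlf : ∀ x : V, (G.neighborSet x).Finite) {U : Set V}
    (hU : ∀ x ∈ U, k < (G.neighborSet x).ncard) : (G.induce U).IsAcyclic := by
  intro v c hc
  have hn : 3 ≤ c.length := hc.three_le_length
  have hlt : ∀ i, i % c.length < c.length := fun i => Nat.mod_lt i (by lia)
  have hsucc : ∀ i, c.getVert ((i + 1) % c.length) = c.getVert (i % c.length + 1) := by
    intro i
    rw [← Nat.mod_add_mod]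
    rcases Nat.lt_or_eq_of_le (hlt i) with hi | hi
    · rw [Nat.mod_eq_of_lt hi]
    · simp [show i % c.length + 1 = c.length from hi]
  obtain ⟨i, hi⟩ := h.exists_ncard_neighborSet_le hlf
    (f := fun i => (c.getVert (i % c.length) : V)) (n := c.length) (by lia)
    (fun i => by simp)
    (fun i => by
      simp only [hsucc]
      exact c.adj_getVert_succ (hlt i))
    (fun i hi => by
      have hmod : i + 0 ≡ i + 2 [MOD c.length] :=
        hc.getVert_injOn' (Nat.le_sub_one_of_lt (hlt i)) (Nat.le_sub_one_of_lt (hlt (i + 2)))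
          (Subtype.ext hi)
      have hdvd := (Nat.modEq_zero_iff_dvd).1 (Nat.ModEq.add_left_cancel' i hmod).symm
      have := Nat.le_of_dvd two_pos hdvd
      lia)
  exact (hU _ (Subtype.prop _)).not_ge hi

lemma KConnected.le_ncard_neighborSet [Infinite V] {G : SimpleGraph V} {k : ℕ}
    (h : KConnected G k) {x : V} (hx : (G.neighborSet x).Finite) :
    k ≤ (G.neighborSet x).ncard := by
  obtain ⟨q, hq⟩ := (hx.insert x).exists_notMem
  rw [Set.mem_insert_iff, not_or] at hq
  refine h.le_ncard_of_separates (P := {x}) hx rfl (by simp) hq.1 hq.2 ?_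
  rintro u rfl v huv
  exact Or.inr huv

/-- Deleting finitely many vertices from an infinite locally finite 2-connected graph leaves a
cycle. -/
lemma KConnected.not_isAcyclic_induce_compl [Infinite V] {G : SimpleGraph V} {k : ℕ}
    (hk : 2 ≤ k) (h : KConnected G k) (hlf : ∀ x : V, (G.neighborSet x).Finite) {D : Set V}
    (hD : D.Finite) : ¬ (G.induce Dᶜ).IsAcyclic := by
  intro hac
  set H := G.induce Dᶜ with hH
  have : Infinite ↥Dᶜ := hD.infinite_compl.to_subtype
  set N : Set ↥Dᶜ := {a | ∃ d ∈ D, G.Adj d a} with hN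
  have hNf : N.Finite := by
    refine Set.Finite.of_finite_image (f := Subtype.val) ?_ Subtype.val_injective.injOn
    refine (hD.biUnion fun d _ => hlf d).subset ?_
    rintro _ ⟨a, ⟨d, hd, hda⟩, rfl⟩
    exact Set.mem_biUnion hd hda
  have hpath : ∀ a b, ∃ X : Set ↥Dᶜ, X.Finite ∧
      (H.Reachable a b → ∃ w : H.Walk a b, ∀ v ∈ w.support, v ∈ X) := by
    intro a b
    by_cases hab : H.Reachable a b
    · obtain ⟨w⟩ := hab
      exact ⟨{v | v ∈ w.support}, w.support.finite_toSet, fun _ => ⟨w, fun _ hv => hv⟩⟩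
    · exact ⟨∅, Set.finite_empty, fun h => absurd h hab⟩
  choose X hXf hX using hpath
  obtain ⟨t, ht⟩ :=
    (hNf.union (hNf.biUnion fun a _ => hNf.biUnion fun b _ => hXf a b)).exists_notMem
  simp only [Set.mem_union, Set.mem_iUnion, not_or, not_exists] at ht
  obtain ⟨htN, htX⟩ := ht
  have hnbr : ∀ u, G.Adj t u → u ∈ Dᶜ := fun u htu huD => htN ⟨u, huD, htu.symm⟩
  have hdeg : 1 < (G.neighborSet t).ncard := by
    have := h.le_ncard_neighborSet (hlf t)
    lia
  obtain ⟨u, v, htu, htv, huv⟩ := (Set.one_lt_ncard_iff (hlf t)).1 hdeg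
  set K := H.deleteEdges {e | t ∈ e} with hK
  have hcon : (G.induce ((({(t : V)} : Finset V) : Set V)ᶜ)).Connected := h.2 _ (by simp; lia)
  -- The component of `K` containing a neighbour of `t` reaches the other neighbours or `N`.
  have hreach : ∀ (p q : V) (hp : G.Adj t p) (hq : G.Adj t q),
      K.Reachable ⟨p, hnbr p hp⟩ ⟨q, hnbr q hq⟩ ∨ ∃ a ∈ N, K.Reachable ⟨p, hnbr p hp⟩ a := by
    intro p q hp hq
    by_contra! ⟨hpq, hno⟩
    obtain ⟨w⟩ := hcon.preconnected ⟨p, by simpa using hp.ne'⟩ ⟨q, by simpa using hq.ne'⟩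
    obtain ⟨d, -, ⟨hd, hd1⟩, hd2⟩ := w.exists_boundary_dart
      {r | ∃ hr : (r : V) ∈ Dᶜ, K.Reachable ⟨p, hnbr p hp⟩ ⟨r, hr⟩}
      ⟨hnbr p hp, Reachable.refl _⟩ (fun ⟨_, h⟩ => hpq h)
    have hadj : G.Adj d.fst d.snd := d.adj
    by_cases hsD : (d.snd : V) ∈ D
    · exact hno _ ⟨_, hsD, hadj.symm⟩ hd1
    · refine hd2 ⟨hsD, hd1.trans (Adj.reachable ?_)⟩
      have h1 : (d.fst : V) ≠ t := by simpa using d.fst.2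
      have h2 : (d.snd : V) ≠ t := by simpa using d.snd.2
      simp [hK, hH, hadj, Subtype.ext_iff, h1.symm, h2.symm]
  have hKH : K ≤ H := deleteEdges_le _
  have hHt : ∀ (p : V) (hp : G.Adj t p), H.Adj t ⟨p, hnbr p hp⟩ := fun p hp => hp
  have huvK : K.Reachable ⟨u, hnbr u htu⟩ ⟨v, hnbr v htv⟩ := by
    rcases hreach u v htu htv with h1 | ⟨a, ha, hua⟩
    · exact h1
    rcases hreach v u htv htu with h1 | ⟨b, hb, hvb⟩
    · exact h1.symm
    have hab : H.Reachable a b := (hua.mono hKH).symm.trans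
      (((hHt u htu).symm.reachable.trans (hHt v htv).reachable).trans (hvb.mono hKH))
    obtain ⟨w, hw⟩ := hX a b hab
    have hwt : t ∉ w.support := fun htw => htX a ha b hb (hw t htw)
    have habK : K.Reachable a b := ⟨w.toDeleteEdges _ fun e he hte =>
      hwt (w.mem_support_of_mem_edges he hte)⟩
    exact (hua.trans habK).trans hvb.symm
  have hbridge := isAcyclic_iff_forall_adj_isBridge.1 hac (hHt u htu)
  rw [isBridge_iff] at hbridge
  refine hbridge ?_
  refine Reachable.trans (Adj.reachable (v := ⟨v, hnbr v htv⟩) ?_) (huvK.symm.mono ?_)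
  · simp [hHt v htv, huv.symm, (hHt u htu).ne]
  · refine deleteEdges_anti ?_
    simp

/-- Halin: an infinite, locally finite, edge-minimally `k`-connected graph (`k ≥ 2`) has
infinitely many vertices of degree `k`. -/
theorem stmt15 {V : Type u} [Infinite V] (G : SimpleGraph V) (k : ℕ) (hk : 2 ≤ k)
    (hlf : ∀ x : V, (G.neighborSet x).Finite)
    (hmin : EdgeMinKConnected G k) :
    {x : V | (G.neighborSet x).ncard = k}.Infinite := by
  intro hfin
  have hU : ∀ x ∈ {x : V | (G.neighborSet x).ncard = k}ᶜ, k < (G.neighborSet x).ncard :=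
    fun x hx => (hmin.1.le_ncard_neighborSet (hlf x)).lt_of_ne' hx
  exact hmin.1.not_isAcyclic_induce_compl hk hlf hfin (hmin.isAcyclic_induce hlf hU)
end

section
/- Let k ≥ 2, let G be a graph, and let C be a finite cycle in an edge-minimally k-connected graph G. Then C contains a vertex of degree k. -/
open SimpleGraph Cardinal

universe u v

variable {V : Type u}

/-- In a `k`-connected graph, fewer than `k` vertices `S` cannot enclose a vertex set `P` with
vertices left outside. -/
theorem KConnected.false_of_separation {G : SimpleGraph V} {k : ℕ} (h : KConnected G k)
    {S : Finset V} (hS : S.card < k) {P : Set V} {a b : V} (ha : a ∈ P) (haS : a ∉ S)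
    (hb : b ∉ P) (hbS : b ∉ S) (hP : ∀ u ∈ P, ∀ w, G.Adj u w → w ∉ S → w ∈ P) : False := by
  obtain ⟨w⟩ := (h.2 S hS).preconnected ⟨a, by simpa using haS⟩ ⟨b, by simpa using hbS⟩
  have key : ∀ {u v : ((S : Set V)ᶜ : Set V)} (_ : (G.induce ((S : Set V))ᶜ).Walk u v),
      (u : V) ∈ P → (v : V) ∈ P := by
    intro u v p
    induction p with
    | nil => exact id
    | @cons u v _ huv _ ih =>
      exact fun hu => ih (hP u hu v huv (mt Finset.mem_coe.2 v.2))
  exact hb (key w ha)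

open Classical in
theorem KConnected.mk_neighborSet_eq {G : SimpleGraph V} {k : ℕ} (h : KConnected G k) {y : V}
    {N : Finset V} (hN : N.card ≤ k) (hy : ∀ w, G.Adj y w → w ∈ N) :
    #(G.neighborSet y) = (k : Cardinal) := by
  have hM : G.neighborSet y = ((N.filter fun w => G.Adj y w : Finset V) : Set V) := by
    ext w
    simpa using hy w
  have hMk : (N.filter fun w => G.Adj y w).card ≤ k := (Finset.card_filter_le _ _).trans hN
  rw [hM]
  refine Cardinal.mk_coe_finset.trans ?_
  congr 1
  refine le_antisymm hMk (not_lt.1 fun hlt => ?_)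
  obtain ⟨b, hb⟩ : ∃ b, b ∉ insert y (N.filter fun w => G.Adj y w) := by
    by_contra! hall
    have h1 : #V ≤ (insert y (N.filter fun w => G.Adj y w)).card := by
      rw [← Cardinal.mk_coe_finset, ← Cardinal.mk_univ]
      exact Cardinal.mk_le_mk_of_subset fun b _ => hall b
    have h2 := Nat.cast_lt.1 (h.1.trans_le h1)
    have h3 := Finset.card_insert_le y (N.filter fun w => G.Adj y w)
    omega
  rw [Finset.mem_insert, not_or] at hb
  refine h.false_of_separation hlt (P := {y}) (a := y) (b := b) rfl (by simp) hb.1 hb.2 ?_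
  rintro u rfl w huw hw
  exact absurd (Finset.mem_filter.2 ⟨hy w huw, huw⟩) hw

/-- The vertex set `T`, of size less than `k`, together with the edge `xy` separates `B`, which
contains `y`, from the remaining vertices, which include `x`. -/
structure IsMixedSeparation (G : SimpleGraph V) (k : ℕ) (x y : V) (T : Finset V) (B : Set V) :
    Prop where
  card_lt : T.card < k
  notMem_of_mem : ∀ v ∈ T, v ∉ B
  right_mem : y ∈ B
  left_notMem : x ∉ B
  left_notMem_sep : x ∉ T
  eq_of_adj : ∀ u v, u ∉ B → u ∉ T → v ∈ B → G.Adj u v → u = x ∧ v = y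

theorem EdgeMinKConnected.exists_isMixedSeparation {G : SimpleGraph V} {k : ℕ}
    (h : EdgeMinKConnected G k) {x y : V} (hxy : G.Adj x y) :
    ∃ T B, IsMixedSeparation G k x y T B := by
  have hnot := h.2 s(x, y) hxy
  rw [KConnected, not_and] at hnot
  have hS := hnot h.1.1
  push Not at hS
  obtain ⟨S, hSk, hS⟩ := hS
  have hconn := h.1.2 S hSk
  let H := (G.deleteEdges {s(x, y)}).induce ((S : Set V))ᶜ
  have : Nonempty ((S : Set V)ᶜ : Set V) := hconn.nonempty
  have hnp : ¬ H.Preconnected := fun hp => hS ⟨hp⟩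
  have hbad : ¬ ∀ u v, (G.induce ((S : Set V))ᶜ).Adj u v → H.Reachable u v := by
    intro hall
    refine hnp fun u v => ?_
    obtain ⟨p⟩ := hconn.preconnected u v
    induction p with
    | nil => exact .refl _
    | cons huv _ ih => exact (hall _ _ huv).trans ih
  have hends : ∃ (hx : x ∉ S) (hy : y ∉ S), ¬ H.Reachable ⟨x, hx⟩ ⟨y, hy⟩ := by
    push Not at hbad
    obtain ⟨⟨u, hu⟩, ⟨v, hv⟩, huv, hnr⟩ := hbad
    have heq : s(u, v) = s(x, y) := by
      by_contra hne
      refine hnr (Adj.reachable ?_)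
      exact (G.deleteEdges_adj).2 ⟨huv, hne⟩
    rcases Sym2.eq_iff.1 heq with ⟨rfl, rfl⟩ | ⟨rfl, rfl⟩
    · exact ⟨hu, hv, hnr⟩
    · exact ⟨hv, hu, fun hr => hnr hr.symm⟩
  obtain ⟨hx, hy, hr⟩ := hends
  refine ⟨S, {v | ∃ hv : v ∉ S, H.Reachable ⟨v, hv⟩ ⟨y, hy⟩}, hSk, ?_, ⟨hy, .refl _⟩, ?_, hx, ?_⟩
  · rintro v hv ⟨hv', _⟩
    exact hv' hv
  · rintro ⟨_, hr'⟩
    exact hr hr'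
  · rintro u v hu huS ⟨hvS, hv⟩ huv
    by_cases heq : s(u, v) = s(x, y)
    · rcases Sym2.eq_iff.1 heq with h' | ⟨rfl, rfl⟩
      · exact h'
      · exact absurd ⟨hy, .refl _⟩ hu
    · refine absurd ⟨huS, Reachable.trans (Adj.reachable ?_) hv⟩ hu
      exact (G.deleteEdges_adj).2 ⟨huv, heq⟩

section Consecutive

variable {G : SimpleGraph V} {k : ℕ} {x y z : V} {T T' : Finset V} {B B' : Set V}

open Classical in
theorem IsMixedSeparation.le_card_add_card (hG : KConnected G k)
    (h : IsMixedSeparation G k x y T B) (h' : IsMixedSeparation G k y z T' B')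
    (hy : #(G.neighborSet y) ≠ (k : Cardinal)) :
    k ≤ (T.filter (· ∉ B')).card + (T'.filter (· ∈ B)).card + 1 := by
  by_contra! hlt
  obtain ⟨-, hT, hyB, hxB, hxT, hB⟩ := h
  obtain ⟨-, hT', -, hyB', hyT', hB'⟩ := h'
  set U := T.filter (· ∉ B') ∪ T'.filter (· ∈ B) with hU
  have hUc := Finset.card_union_le (T.filter (· ∉ B')) (T'.filter (· ∈ B))
  rw [← hU] at hUc
  have hout : ∀ u w, u ∈ B → u ∉ B' → u ∉ T' → G.Adj u w → w ∉ U →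
      (w ∈ B ∧ w ∉ B' ∧ w ∉ T') ∨ (u = y ∧ (w = x ∨ w = z)) := by
    intro u w hu hu' hut huw hw
    simp only [hU, Finset.mem_union, Finset.mem_filter, not_or, not_and, not_not] at hw
    by_cases hwB : w ∈ B
    · by_cases hwB' : w ∈ B'
      · obtain ⟨rfl, rfl⟩ := hB' u w hu' hut hwB' huw
        exact .inr ⟨rfl, .inr rfl⟩
      · exact .inl ⟨hwB, hwB', fun hwT' => hw.2 hwT' hwB⟩
    · by_cases hwT : w ∈ T
      · obtain ⟨rfl, rfl⟩ := hB' u w hu' hut (hw.1 hwT) huw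
        exact .inr ⟨rfl, .inr rfl⟩
      · obtain ⟨rfl, rfl⟩ := hB w u hwB hwT hu huw.symm
        exact .inr ⟨rfl, .inl rfl⟩
  have hxU : x ∉ U := by
    simp only [hU, Finset.mem_union, Finset.mem_filter]
    tauto
  have hxy : x ≠ y := by
    rintro rfl
    exact hxB hyB
  have hsingle : ∀ v ∈ B, v ∉ B' → v ∉ T' → v = y := by
    intro v hv hv' hvt
    by_contra hvy
    have hvU : v ∉ U := by
      have := hT v
      simp only [hU, Finset.mem_union, Finset.mem_filter]
      tauto
    have hc := Finset.card_insert_le y U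
    refine hG.false_of_separation (S := insert y U) (by omega)
      (P := {u | u ∈ B ∧ u ∉ B' ∧ u ∉ T' ∧ u ≠ y}) (a := v) (b := x) ⟨hv, hv', hvt, hvy⟩
      (by simp [hvy, hvU]) (fun hx => hxB hx.1) (by simp [hxy, hxU]) ?_
    rintro u ⟨hu, hu', hut, huy⟩ w huw hw
    rw [Finset.mem_insert, not_or] at hw
    have := hout u w hu hu' hut huw hw.2
    simp only [Set.mem_ofPred_eq]
    tauto
  refine hy (hG.mk_neighborSet_eq (N := insert x (insert z U)) ?_ fun w hw => ?_)
  · have h1 := Finset.card_insert_le x (insert z U)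
    have h2 := Finset.card_insert_le z U
    omega
  · by_contra hwN
    simp only [Finset.mem_insert, not_or] at hwN
    rcases hout y w hyB hyB' hyT' hw hwN.2.2 with ⟨h1, h2, h3⟩ | ⟨-, h1 | h1⟩
    · exact hw.ne (hsingle w h1 h2 h3).symm
    · exact hwN.1 h1
    · exact hwN.2.1 h1

open Classical in
theorem IsMixedSeparation.card_filter_le (hG : KConnected G k)
    (h : IsMixedSeparation G k x y T B) (h' : IsMixedSeparation G k y z T' B')
    (hy : #(G.neighborSet y) ≠ (k : Cardinal)) :
    (T.filter (· ∈ B')).card ≤ (T'.filter (· ∈ B)).card := by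
  have h1 := h.le_card_add_card hG h' hy
  have h2 := T.card_filter_add_card_filter_not (· ∈ B')
  have h3 := h.card_lt
  omega

open Classical in
theorem IsMixedSeparation.mem_of_mem_of_notMem (hG : KConnected G k)
    (h : IsMixedSeparation G k x y T B) (h' : IsMixedSeparation G k y z T' B')
    (hxz : x ≠ z) (hy : #(G.neighborSet y) ≠ (k : Cardinal)) {v : V} (hv' : v ∈ B')
    (hv : v ∉ B) : v ∈ T := by
  by_contra hvT
  have h1 := h.card_filter_le hG h' hy
  have h2 := T'.card_filter_add_card_filter_not (· ∈ B)
  have h3 := h'.card_lt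
  have hUc := Finset.card_union_le (T.filter (· ∈ B')) (T'.filter (· ∉ B))
  obtain ⟨-, hT, hyB, hxB, hxT, hB⟩ := h
  obtain ⟨-, hT', -, hyB', hyT', hB'⟩ := h'
  refine hG.false_of_separation (S := T.filter (· ∈ B') ∪ T'.filter (· ∉ B)) (by omega)
    (P := {u | u ∈ B' ∧ u ∉ B ∧ u ∉ T}) (a := v) (b := y) ⟨hv', hv, hvT⟩ ?_
    (fun hy => hyB' hy.1) ?_ ?_
  · have := hT' v
    simp only [Finset.mem_union, Finset.mem_filter]
    tauto
  · simp only [Finset.mem_union, Finset.mem_filter]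
    tauto
  · rintro u ⟨hu', hu, hut⟩ w huw hw
    simp only [Finset.mem_union, Finset.mem_filter] at hw
    simp only [Set.mem_ofPred_eq]
    have h4 := hB u w hu hut
    have h5 := fun a b => hB' w u a b hu' huw.symm
    by_cases hwB : w ∈ B
    · obtain ⟨rfl, rfl⟩ := h4 hwB huw
      exact absurd (h5 hyB' hyT').2 hxz
    · by_cases hwB' : w ∈ B'
      · tauto
      · obtain ⟨rfl, rfl⟩ := h5 hwB' (by tauto)
        exact absurd hyB hwB

open Classical in
theorem IsMixedSeparation.card_filter_lt (hG : KConnected G k)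
    (h : IsMixedSeparation G k x y T B) (h' : IsMixedSeparation G k y z T' B')
    (hxz : x ≠ z) (hy : #(G.neighborSet y) ≠ (k : Cardinal)) {D : Finset V}
    (hD : ∀ v ∈ B, v ∉ B' → v ∈ D) :
    (D.filter (· ∈ B')).card < (D.filter (· ∈ B)).card := by
  have hle := h.card_filter_le hG h' hy
  rw [← Finset.card_sdiff_lt_card_sdiff_iff]
  have h1 : (D.filter (· ∈ B') \ D.filter (· ∈ B)).card ≤ (T.filter (· ∈ B')).card := by
    refine Finset.card_le_card fun v hv => ?_
    simp only [Finset.mem_sdiff, Finset.mem_filter, not_and] at hv ⊢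
    exact ⟨h.mem_of_mem_of_notMem hG h' hxz hy hv.1.2 (hv.2 hv.1.1), hv.1.2⟩
  have h2 : insert y (T'.filter (· ∈ B)) ⊆ D.filter (· ∈ B) \ D.filter (· ∈ B') := by
    have hyD := hD y h.right_mem h'.left_notMem
    intro v hv
    simp only [Finset.mem_insert, Finset.mem_sdiff, Finset.mem_filter, not_and] at hv ⊢
    rcases hv with rfl | ⟨hv, hvB⟩
    · exact ⟨⟨hyD, h.right_mem⟩, fun _ => h'.left_notMem⟩
    · have := h'.notMem_of_mem v hv
      exact ⟨⟨hD v hvB this, hvB⟩, fun _ => this⟩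
  have h3 := Finset.card_le_card h2
  rw [Finset.card_insert_of_notMem (by simp [h'.left_notMem_sep])] at h3
  omega

end Consecutive

theorem exists_mk_neighborSet_eq_of_periodic {G : SimpleGraph V} {k : ℕ}
    (hmin : EdgeMinKConnected G k) {n : ℕ} (hn : 0 < n) (v : ℕ → V)
    (hper : ∀ i, v (i + n) = v i) (hadj : ∀ i, G.Adj (v i) (v (i + 1)))
    (hne : ∀ i, v i ≠ v (i + 2)) : ∃ i, #(G.neighborSet (v i)) = (k : Cardinal) := by
  classical
  by_contra! hdeg
  choose! T B hTB using fun x y (hxy : G.Adj x y) => hmin.exists_isMixedSeparation hxy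
  have hsep := fun i => hTB _ _ (hadj i)
  have hperB : ∀ i, B (v (i + n)) (v (i + n + 1)) = B (v i) (v (i + 1)) := fun i => by
    rw [add_right_comm, hper, hper]
  have hstep : ∀ i, ∀ w, w ∈ B (v (i + 1)) (v (i + 1 + 1)) → w ∉ B (v i) (v (i + 1)) →
      w ∈ T (v i) (v (i + 1)) := fun i w =>
    (hsep i).mem_of_mem_of_notMem hmin.1 (hsep (i + 1)) (hne i) (hdeg _)
  let D := (Finset.range n).biUnion fun i => T (v i) (v (i + 1))
  have hTD : ∀ i, T (v i) (v (i + 1)) ⊆ D := by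
    intro i
    have hmod : ∀ j, v (j % n) = v j := fun j => (show Function.Periodic v n from hper).map_mod_nat j
    have h1 : v (i % n + 1) = v (i + 1) := by
      rw [← hmod (i % n + 1), ← hmod (i + 1), Nat.mod_add_mod]
    rw [← hmod i, ← h1]
    exact Finset.subset_biUnion_of_mem (fun i => T (v i) (v (i + 1)))
      (Finset.mem_range.2 (Nat.mod_lt i hn))
  have hD : ∀ i, ∀ w ∈ B (v i) (v (i + 1)), w ∉ B (v (i + 1)) (v (i + 1 + 1)) → w ∈ D := by
    intro i w hw hw'
    by_contra hwD
    have hall : ∀ j, w ∉ B (v (i + 1 + j)) (v (i + 1 + j + 1)) := by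
      intro j
      induction j with
      | zero => exact hw'
      | succ j ih => exact fun hj => hwD (hTD _ (hstep _ w hj ih))
    have := hall (n - 1)
    rw [show i + 1 + (n - 1) = i + n by omega, hperB] at this
    exact this hw
  have hanti : StrictAnti fun i => (D.filter (· ∈ B (v i) (v (i + 1)))).card :=
    strictAnti_nat_of_succ_lt fun i =>
      (hsep i).card_filter_lt hmin.1 (hsep (i + 1)) (hne i) (hdeg _) (hD i)
  exact not_strictAnti_of_wellFoundedLT _ hanti

/-- Mader: every finite cycle of an edge-minimally `k`-connected graph (`k ≥ 2`) contains a
vertex of degree `k`. -/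
theorem stmt16 {V : Type u} (G : SimpleGraph V) (k : ℕ) (hk : 2 ≤ k)
    (hmin : EdgeMinKConnected G k) (x : V) (c : G.Walk x x) (hc : c.IsCycle) :
    ∃ y ∈ c.support, #(G.neighborSet y) = (k : Cardinal) := by
  have hlen := hc.three_le_length
  have hnil : c.getVert c.length = c.getVert 0 := by simp
  have hsucc : ∀ i, c.getVert ((i + 1) % c.length) = c.getVert (i % c.length + 1) := by
    intro i
    rw [← Nat.mod_add_mod]
    rcases (Nat.succ_le_of_lt (Nat.mod_lt i (by omega : 0 < c.length))).lt_or_eq with h | h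
    · rw [Nat.mod_eq_of_lt h]
    · rw [Nat.succ_eq_add_one] at h
      rw [h, Nat.mod_self, hnil]
  obtain ⟨i, hi⟩ := exists_mk_neighborSet_eq_of_periodic hmin (n := c.length) (by omega)
    (fun i => c.getVert (i % c.length)) (fun i => by simp)
    (fun i => by
      rw [hsucc]
      exact c.adj_getVert_succ (Nat.mod_lt i (by omega)))
    (fun i h => by
      have h1 := Nat.mod_lt i (by omega : 0 < c.length)
      have h2 := Nat.mod_lt (i + 2) (by omega : 0 < c.length)
      have h3 := hc.getVert_injOn' (by simp; omega) (by simp; omega) h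
      have h4 := (Nat.modEq_iff_dvd' (by omega : i ≤ i + 2)).1 h3
      have h5 := Nat.le_of_dvd (by omega) h4
      omega)
  exact ⟨_, c.getVert_mem_support _, hi⟩
end

section
/- Every subgraph H of an infinite edge-minimally k-connected graph G has a vertex of degree at most k in H, or an end of vertex-degree 1 in H. -/
open SimpleGraph Cardinal

universe u v

variable {V : Type u}

section Separation

variable {G : SimpleGraph V} {k : ℕ}

theorem ncard_add_ncard_le_of_subset {S T X Y : Set V} (hS : S.Finite) (hT : T.Finite)
    (hu : X ∪ Y ⊆ S ∪ T) (hi : X ∩ Y ⊆ S ∩ T) : X.ncard + Y.ncard ≤ S.ncard + T.ncard := by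
  have hXY := (hS.union hT).subset hu
  rw [← Set.ncard_union_add_ncard_inter X Y (hXY.subset Set.subset_union_left)
      (hXY.subset Set.subset_union_right), ← Set.ncard_union_add_ncard_inter S T hS hT]
  exact Nat.add_le_add (Set.ncard_le_ncard hu (hS.union hT))
    (Set.ncard_le_ncard hi (hS.subset Set.inter_subset_left))

theorem KConnected.le_ncard_compl (hG : KConnected G k) {P Q : Set V} (hP : P.Nonempty)
    (hQ : Q.Nonempty) (hd : Disjoint P Q) (hno : ∀ a ∈ P, ∀ b ∈ Q, ¬ G.Adj a b)
    (hf : (P ∪ Q)ᶜ.Finite) : k ≤ (P ∪ Q)ᶜ.ncard := by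
  by_contra! hlt
  obtain ⟨p, hp⟩ := hP
  obtain ⟨q, hq⟩ := hQ
  rw [Set.ncard_eq_toFinset_card _ hf] at hlt
  have hcon := (hG.2 hf.toFinset hlt).preconnected ⟨p, by simp [hp]⟩ ⟨q, by simp [hq]⟩
  obtain ⟨w⟩ := hcon
  have key : ∀ {a b : ((hf.toFinset : Set V)ᶜ : Set V)},
      (G.induce ((hf.toFinset : Set V)ᶜ)).Walk a b → (a : V) ∈ P → (b : V) ∈ P := by
    intro a b w
    induction w with
    | nil => exact id
    | @cons u v _ huv _ ih =>
      intro hu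
      apply ih
      have hv := v.2
      simp only [Set.Finite.coe_toFinset, compl_compl] at hv
      exact hv.resolve_right fun h => hno _ hu _ h huv
  exact Set.disjoint_left.1 hd (key w hp) hq

theorem KConnected.le_ncard_compl_add_one [Infinite V] (hG : KConnected G k) {P Q : Set V}
    {x y : V} (hP : P.Nonempty) (hQ : Q.Nonempty) (hd : Disjoint P Q)
    (hno : ∀ a ∈ P, ∀ b ∈ Q, G.Adj a b → a = x ∧ b = y)
    (hf : (P ∪ Q)ᶜ.Finite) : k ≤ (P ∪ Q)ᶜ.ncard + 1 := by
  have bound : ∀ (P' Q' : Set V) (v : V), P'.Nonempty → Q'.Nonempty → P' ⊆ P → Q' ⊆ Q →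
      (P' ∪ Q')ᶜ ⊆ insert v (P ∪ Q)ᶜ → (x ∉ P' ∨ y ∉ Q') → k ≤ (P ∪ Q)ᶜ.ncard + 1 := by
    intro P' Q' v hP' hQ' hPP hQQ hsub hxy
    refine (hG.le_ncard_compl hP' hQ' (hd.mono hPP hQQ) ?_
      ((hf.insert v).subset hsub)).trans
      ((Set.ncard_le_ncard hsub (hf.insert v)).trans (Set.ncard_insert_le _ _))
    intro a ha b hb hab
    obtain ⟨rfl, rfl⟩ := hno a (hPP ha) b (hQQ hb) hab
    exact hxy.elim (fun h => h ha) (fun h => h hb)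
  by_cases h₁ : (P \ {x}).Nonempty
  · refine bound (P \ {x}) Q x h₁ hQ Set.sdiff_subset subset_rfl ?_ (by simp)
    intro v; simp; tauto
  by_cases h₂ : (Q \ {y}).Nonempty
  · refine bound P (Q \ {y}) y hP h₂ subset_rfl Set.sdiff_subset ?_ (by simp)
    intro v; simp; tauto
  exfalso
  rw [Set.not_nonempty_iff_eq_empty, Set.sdiff_eq_empty] at h₁ h₂
  have := ((Set.finite_singleton x).subset h₁).union ((Set.finite_singleton y).subset h₂)
  exact Set.infinite_univ (α := V) (Set.union_compl_self (P ∪ Q) ▸ this.union hf)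

theorem KConnected.le_ncard_compl_add_one_of_lt_degree (hG : KConnected G k) {P Q : Set V}
    {x y z : V} (hy : y ∈ P) (hdeg : (k : Cardinal) < #(G.neighborSet y))
    (hQ : Q.Nonempty) (hd : Disjoint P Q)
    (hno : ∀ a ∈ P, ∀ b ∈ Q, G.Adj a b → a = y ∧ (b = x ∨ b = z))
    (hf : (P ∪ Q)ᶜ.Finite) : k ≤ (P ∪ Q)ᶜ.ncard + 1 := by
  by_cases h₁ : (P \ {y}).Nonempty
  · have hsub : ((P \ {y}) ∪ Q)ᶜ ⊆ insert y (P ∪ Q)ᶜ := by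
      intro v; simp; tauto
    refine (hG.le_ncard_compl h₁ hQ (hd.mono_left Set.sdiff_subset) ?_
      ((hf.insert y).subset hsub)).trans
      ((Set.ncard_le_ncard hsub (hf.insert y)).trans (Set.ncard_insert_le _ _))
    intro a ha b hb hab
    exact ha.2 (hno a ha.1 b hb hab).1
  · rw [Set.not_nonempty_iff_eq_empty, Set.sdiff_eq_empty] at h₁
    have hsub : G.neighborSet y ⊆ insert x (insert z (P ∪ Q)ᶜ) := by
      intro v hv
      by_cases hvQ : v ∈ Q
      · rcases (hno y hy v hvQ hv).2 with rfl | rfl <;> simp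
      · by_cases hvP : v ∈ P
        · exact absurd (h₁ hvP).symm (G.ne_of_adj hv)
        · simp [hvP, hvQ]
    have hfin := ((hf.insert z).insert x)
    rw [← Set.cast_ncard (hfin.subset hsub), Nat.cast_lt] at hdeg
    have h₂ := Set.ncard_le_ncard hsub hfin
    have h₃ := Set.ncard_insert_le x (insert z (P ∪ Q)ᶜ)
    have h₄ := Set.ncard_insert_le z (P ∪ Q)ᶜ
    omega

/-- `A` and `B` are the two sides of a separation of order less than `k` of the graph obtained
from `G` by deleting the edge `xy`, with `x ∈ A` and `y ∈ B`. -/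
structure SeparatesEdge (G : SimpleGraph V) (k : ℕ) (x y : V) (A B : Set V) : Prop where
  left_mem : x ∈ A
  right_mem : y ∈ B
  disjoint : Disjoint A B
  finite : (A ∪ B)ᶜ.Finite
  ncard_lt : (A ∪ B)ᶜ.ncard < k
  eq_of_adj : ∀ a ∈ A, ∀ b ∈ B, G.Adj a b → a = x ∧ b = y

theorem SeparatesEdge.symm {x y : V} {A B : Set V} (h : SeparatesEdge G k x y A B) :
    SeparatesEdge G k y x B A where
  left_mem := h.right_mem
  right_mem := h.left_mem
  disjoint := h.disjoint.symm
  finite := by rw [Set.union_comm]; exact h.finite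
  ncard_lt := by rw [Set.union_comm]; exact h.ncard_lt
  eq_of_adj b hb a ha hba := (h.eq_of_adj a ha b hb hba.symm).symm

theorem EdgeMinKConnected.exists_separatesEdge [Infinite V] (hmin : EdgeMinKConnected G k)
    {x y : V} (hxy : G.Adj x y) : ∃ A B, SeparatesEdge G k x y A B := by
  have hnot := hmin.2 s(x, y) hxy
  simp only [KConnected, hmin.1.1, true_and, not_forall] at hnot
  obtain ⟨S, hS, hcon⟩ := hnot
  set K := (G.deleteEdges {s(x, y)}).induce ((S : Set V)ᶜ) with hK
  have : Nonempty ((S : Set V)ᶜ : Set V) := S.finite_toSet.infinite_compl.nonempty.to_subtype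
  have hpre : ¬ K.Preconnected := fun h => hcon ⟨h⟩
  simp only [SimpleGraph.Preconnected, not_forall] at hpre
  obtain ⟨u, v, huv⟩ := hpre
  set P : Set V := Subtype.val '' {w | K.Reachable u w} with hP
  set Q : Set V := Subtype.val '' {w | ¬ K.Reachable u w} with hQ
  have hd : Disjoint P Q :=
    (Set.disjoint_image_iff Subtype.val_injective).2
      (disjoint_compl_right (a := {w | K.Reachable u w}))
  have hPQ : (P ∪ Q)ᶜ = S := by
    have hcover : {w | K.Reachable u w} ∪ {w | ¬ K.Reachable u w} = Set.univ :=
      Set.union_compl_self _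
    rw [hP, hQ, ← Set.image_union, hcover, Set.image_univ, Subtype.range_coe, compl_compl]
  have hedge : ∀ a ∈ P, ∀ b ∈ Q, G.Adj a b → s(a, b) = s(x, y) := by
    rintro _ ⟨a, ha, rfl⟩ _ ⟨b, hb, rfl⟩ hab
    by_contra hne
    refine hb (ha.trans (SimpleGraph.Adj.reachable ?_))
    simpa [hK, SimpleGraph.deleteEdges_adj, hab] using hne
  have hfin : (P ∪ Q)ᶜ.Finite := hPQ ▸ S.finite_toSet
  have hlt : (P ∪ Q)ᶜ.ncard < k := by rw [hPQ, Set.ncard_coe_finset]; exact hS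
  have hex : ∃ a ∈ P, ∃ b ∈ Q, G.Adj a b := by
    by_contra! hno
    exact hlt.not_ge (hmin.1.le_ncard_compl ⟨u, u, .refl u, rfl⟩ ⟨v, v, huv, rfl⟩ hd hno hfin)
  obtain ⟨a, ha, b, hb, hab⟩ := hex
  have main : SeparatesEdge G k a b P Q := by
    refine ⟨ha, hb, hd, hfin, hlt, fun c hc d hd' hcd => ?_⟩
    have h := (hedge c hc d hd' hcd).trans (hedge a ha b hb hab).symm
    rcases Sym2.eq_iff.1 h with h | ⟨rfl, rfl⟩
    · exact h
    · exact absurd hb (Set.disjoint_left.1 hd hc)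
  rcases Sym2.eq_iff.1 (hedge a ha b hb hab) with ⟨rfl, rfl⟩ | ⟨rfl, rfl⟩
  · exact ⟨P, Q, main⟩
  · exact ⟨Q, P, main.symm⟩

theorem EdgeMinKConnected.exists_separatesEdge_next [Infinite V] (hmin : EdgeMinKConnected G k)
    {x y z : V} {A B : Set V} (hAB : SeparatesEdge G k x y A B) (hyz : G.Adj y z)
    (hxz : x ≠ z) (hdeg : (k : Cardinal) < #(G.neighborSet y)) :
    A.Finite ∨ ∃ C D, SeparatesEdge G k y z C D ∧ (A ⊆ C ∨ D.Finite) ∧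
      (B.Finite → D.Finite ∧ D.ncard < B.ncard) := by
  obtain ⟨C, D, hCD⟩ := hmin.exists_separatesEdge hyz
  have dAB : ∀ v, v ∈ A → v ∉ B := fun _ => (Set.disjoint_left.1 hAB.disjoint ·)
  have dCD : ∀ v, v ∈ C → v ∉ D := fun _ => (Set.disjoint_left.1 hCD.disjoint ·)
  obtain ⟨hxA, hyB, -, fS, cS, eAB⟩ := hAB
  obtain ⟨hyC, hzD, -, fT, cT, eCD⟩ := hCD
  have fin : ∀ X : Set V, X ⊆ (A ∪ B)ᶜ ∪ (C ∪ D)ᶜ → X.Finite := fun X =>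
    (fS.union fT).subset
  have f₁ : ((B ∩ C) ∪ (A ∪ D))ᶜ.Finite := fin _ (by intro v; simp; tauto)
  have h₁ : k ≤ ((B ∩ C) ∪ (A ∪ D))ᶜ.ncard + 1 := by
    refine hmin.1.le_ncard_compl_add_one_of_lt_degree (x := x) (y := y) (z := z) ⟨hyB, hyC⟩ hdeg
      ⟨x, .inl hxA⟩ ?_ ?_ f₁
    · rw [Set.disjoint_left]; rintro v ⟨h, h'⟩ (h'' | h'')
      exacts [dAB v h'' h, dCD v h' h'']
    · rintro a ⟨haB, haC⟩ b (hb | hb) hab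
      · obtain ⟨rfl, rfl⟩ := eAB b hb a haB hab.symm
        simp
      · obtain ⟨rfl, rfl⟩ := eCD a haC b hb hab
        simp
  have hAD : ∀ v, v ∈ A → v ∉ D := by
    intro v hvA hvD
    have f₂ : ((A ∩ D) ∪ (B ∪ C))ᶜ.Finite := fin _ (by intro v; simp; tauto)
    have h₂ : k ≤ ((A ∩ D) ∪ (B ∪ C))ᶜ.ncard := by
      refine hmin.1.le_ncard_compl ⟨v, hvA, hvD⟩ ⟨y, .inl hyB⟩ ?_ ?_ f₂
      · rw [Set.disjoint_left]; rintro v ⟨h, h'⟩ (h'' | h'')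
        exacts [dAB v h h'', dCD v h'' h']
      · rintro a ⟨haA, haD⟩ b (hb | hb) hab
        · obtain ⟨rfl, rfl⟩ := eAB a haA b hb hab
          exact hxz (eCD b hyC a haD hab.symm).2
        · obtain ⟨rfl, rfl⟩ := eCD b hb a haD hab.symm
          exact hxz (eAB a haA b hyB hab).1.symm
    have := ncard_add_ncard_le_of_subset (X := ((B ∩ C) ∪ (A ∪ D))ᶜ)
      (Y := ((A ∩ D) ∪ (B ∪ C))ᶜ) fS fT
      (by intro v; simp; tauto) (by intro v; simp; tauto)
    omega
  by_cases hAC : (A ∩ C).Nonempty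
  swap
  · refine .inl (fT.subset fun v hv hv' => ?_)
    rcases hv' with h | h
    exacts [hAC ⟨v, hv, h⟩, hAD v hv h]
  right
  by_cases hBD : (B ∩ D).Nonempty
  swap
  · have hDS : D ⊆ (A ∪ B)ᶜ := by
      rintro v hv (h | h)
      exacts [hAD v h hv, hBD ⟨v, h, hv⟩]
    have hD : D.Finite := fS.subset hDS
    refine ⟨C, D, ⟨hyC, hzD, Set.disjoint_left.2 dCD, fT, cT, eCD⟩, .inr hD, fun hB => ⟨hD, ?_⟩⟩
    have h₃ := ncard_add_ncard_le_of_subset (X := ((B ∩ C) ∪ (A ∪ D))ᶜ) (Y := D)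
      (S := (A ∪ B)ᶜ) (T := B ∩ (C ∪ D)ᶜ) fS (fT.subset Set.inter_subset_right)
      (by
        rintro v (h | h)
        · simp at h ⊢; grind
        · exact .inl (hDS h))
      (by intro v; simp)
    have h₄ : (B ∩ (C ∪ D)ᶜ).ncard < B.ncard :=
      Set.ncard_lt_ncard ⟨Set.inter_subset_left, fun h => (h hyB).2 (.inl hyC)⟩ hB
    omega
  have f₂ : ((A ∩ C) ∪ (B ∪ D))ᶜ.Finite := fin _ (by intro v; simp; tauto)
  have f₃ : ((A ∪ C) ∪ (B ∩ D))ᶜ.Finite := fin _ (by intro v; simp; tauto)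
  have d₂ : Disjoint (A ∩ C) (B ∪ D) := by
    rw [Set.disjoint_left]; rintro v ⟨h, h'⟩ (h'' | h'')
    exacts [dAB v h h'', dCD v h' h'']
  have d₃ : Disjoint (A ∪ C) (B ∩ D) := by
    rw [Set.disjoint_left]; rintro v (h'' | h'') ⟨h, h'⟩
    exacts [dAB v h'' h, dCD v h'' h']
  have e₂ : ∀ a ∈ A ∩ C, ∀ b ∈ B ∪ D, G.Adj a b → a = x ∧ b = y := by
    rintro a ⟨haA, haC⟩ b (hb | hb) hab
    · exact eAB a haA b hb hab
    · obtain ⟨rfl, rfl⟩ := eCD a haC b hb hab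
      exact absurd hyB (dAB _ haA)
  have e₃ : ∀ a ∈ A ∪ C, ∀ b ∈ B ∩ D, G.Adj a b → a = y ∧ b = z := by
    rintro a (ha | ha) b ⟨hbB, hbD⟩ hab
    · obtain ⟨rfl, rfl⟩ := eAB a ha b hbB hab
      exact absurd hbD (dCD _ hyC)
    · exact eCD a ha b hbD hab
  have h₂ := hmin.1.le_ncard_compl_add_one hAC ⟨y, .inl hyB⟩ d₂ e₂ f₂
  have h₃ := hmin.1.le_ncard_compl_add_one ⟨y, .inr hyC⟩ hBD d₃ e₃ f₃
  have hsum := ncard_add_ncard_le_of_subset (X := ((A ∩ C) ∪ (B ∪ D))ᶜ)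
    (Y := ((A ∪ C) ∪ (B ∩ D))ᶜ) fS fT
    (by intro v; simp; tauto) (by intro v; simp; tauto)
  have hzB : z ∈ B := by
    by_contra hzB
    have := hmin.1.le_ncard_compl ⟨y, .inr hyC⟩ hBD d₃
      (fun a ha b hb hab => hzB ((e₃ a ha b hb hab).2 ▸ hb.1)) f₃
    omega
  refine ⟨A ∪ C, B ∩ D, ⟨.inr hyC, ⟨hzB, hzD⟩, d₃, f₃, by omega, e₃⟩,
    .inl Set.subset_union_left, fun hB => ⟨hB.subset Set.inter_subset_left, ?_⟩⟩
  exact Set.ncard_lt_ncard ⟨Set.inter_subset_left, fun h => dCD _ hyC (h hyB).2⟩ hB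

end Separation

section HighDegree

variable {W : Type u} {G : SimpleGraph V} {K : SimpleGraph W} {k : ℕ}

theorem exists_adj_ne_of_one_le_of_lt_degree (hk : 1 ≤ k) {y : W}
    (hdeg : (k : Cardinal) < #(K.neighborSet y)) (x : W) : ∃ z, K.Adj y z ∧ x ≠ z := by
  have h : (1 : Cardinal) < #(K.neighborSet y) :=
    lt_of_le_of_lt (by exact_mod_cast hk) hdeg
  have := Cardinal.one_lt_iff_nontrivial.1 h
  obtain ⟨z, hz, hne⟩ := (Set.nontrivial_coe_sort.1 this).exists_ne x
  exact ⟨z, hz, hne.symm⟩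

theorem SimpleGraph.Copy.lt_degree (φ : Copy K G) {y : W}
    (hdeg : (k : Cardinal) < #(K.neighborSet y)) : (k : Cardinal) < #(G.neighborSet (φ y)) :=
  hdeg.trans_le (Cardinal.mk_le_of_injective (φ.mapNeighborSet y).injective)

variable [Infinite V]

theorem EdgeMinKConnected.infinite_right (hmin : EdgeMinKConnected G k) (φ : Copy K G)
    (hdeg : ∀ y, (k : Cardinal) < #(K.neighborSet y)) {x y : W} {A B : Set V}
    (hAB : SeparatesEdge G k (φ x) (φ y) A B) : B.Infinite := by
  intro hB
  induction hn : B.ncard using Nat.strong_induction_on generalizing x y A B with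
  | _ n ih =>
    subst hn
    obtain ⟨z, hyz, hxz⟩ := exists_adj_ne_of_one_le_of_lt_degree
      (Nat.one_le_iff_ne_zero.2 (Nat.ne_zero_of_lt hAB.ncard_lt)) (hdeg y) x
    rcases hmin.exists_separatesEdge_next hAB (φ.toHom.map_adj hyz) (φ.injective.ne hxz)
      (φ.lt_degree (hdeg y)) with hA | ⟨C, D, hCD, -, hlt⟩
    · exact Set.infinite_univ (α := V)
        (Set.union_compl_self (A ∪ B) ▸ (hA.union hB).union hAB.finite)
    · exact ih _ (hlt hB).2 hCD (hlt hB).1 rfl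

theorem EdgeMinKConnected.exists_superset_next (hmin : EdgeMinKConnected G k) (φ : Copy K G)
    (hdeg : ∀ y, (k : Cardinal) < #(K.neighborSet y)) {x y z : W} {A B : Set V}
    (hAB : SeparatesEdge G k (φ x) (φ y) A B) (hyz : K.Adj y z) (hxz : x ≠ z) :
    ∃ C D, SeparatesEdge G k (φ y) (φ z) C D ∧ A ⊆ C := by
  rcases hmin.exists_separatesEdge_next hAB (φ.toHom.map_adj hyz) (φ.injective.ne hxz)
    (φ.lt_degree (hdeg y)) with hA | ⟨C, D, hCD, hAC, -⟩
  · exact absurd hA (hmin.infinite_right φ hdeg hAB.symm)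
  · exact ⟨C, D, hCD, hAC.resolve_right (hmin.infinite_right φ hdeg hCD)⟩

/-- A graph with all degrees greater than `k` that has a copy in an infinite edge-minimally
`k`-connected graph is acyclic. -/
theorem EdgeMinKConnected.isAcyclic (hmin : EdgeMinKConnected G k) (φ : Copy K G)
    (hdeg : ∀ y, (k : Cardinal) < #(K.neighborSet y)) : K.IsAcyclic := by
  classical
  have key : ∀ {u w : W} (q : K.Walk u w), q.IsTrail → ∀ (a : W) (A B : Set V),
      SeparatesEdge G k (φ a) (φ u) A B → s(a, u) ∉ q.edges →
      ∃ C D, A ⊆ C ∧ φ w ∈ D ∧ Disjoint C D := by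
    intro u w q
    induction q with
    | nil => exact fun _ a A B hAB _ => ⟨A, B, subset_rfl, hAB.right_mem, hAB.disjoint⟩
    | @cons u v w huv q ih =>
      intro hq a A B hAB ha
      rw [Walk.isTrail_cons] at hq
      have hav : a ≠ v := by
        rintro rfl
        exact ha (by simp [Sym2.eq_swap])
      obtain ⟨C, D, hCD, hAC⟩ := hmin.exists_superset_next φ hdeg hAB huv hav
      obtain ⟨C', D', h, h'⟩ := ih hq.1 u C D hCD hq.2
      exact ⟨C', D', hAC.trans h, h'⟩
  rw [isAcyclic_iff_forall_adj_isBridge]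
  intro x y hxy
  rw [isBridge_iff_forall_walk_mem_edges]
  intro p
  by_contra hp
  obtain ⟨A, B, hAB⟩ := hmin.exists_separatesEdge (φ.toHom.map_adj hxy.symm)
  obtain ⟨C, D, hAC, hD, hd⟩ := key p.bypass p.bypass_isPath.isTrail y A B hAB
    (fun h => hp (p.edges_bypass_subset_edges (Sym2.eq_swap ▸ h)))
  exact Set.disjoint_left.1 hd (hAC hAB.left_mem) hD

theorem EdgeMinKConnected.exists_isRay (hmin : EdgeMinKConnected G k) (φ : Copy K G)
    (hdeg : ∀ y, (k : Cardinal) < #(K.neighborSet y)) [Nonempty W] : ∃ f, IsRay K f := by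
  obtain ⟨x₀⟩ := ‹Nonempty W›
  obtain ⟨⟨y₀, h₀⟩⟩ := Cardinal.mk_ne_zero_iff.1 (zero_le.trans_lt (hdeg x₀)).ne'
  obtain ⟨A₀, B₀, hAB₀⟩ := hmin.exists_separatesEdge (φ.toHom.map_adj h₀)
  have hk : 1 ≤ k := Nat.one_le_iff_ne_zero.2 (Nat.ne_zero_of_lt hAB₀.ncard_lt)
  choose next hadj hne using fun x y : W =>
    exists_adj_ne_of_one_le_of_lt_degree hk (hdeg y) x
  let s : ℕ → W × W := fun n => (fun p : W × W => (p.2, next p.1 p.2))^[n] (x₀, y₀)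
  have hs : ∀ n, s (n + 1) = ((s n).2, next (s n).1 (s n).2) := fun n =>
    Function.iterate_succ_apply' _ n _
  have hsadj : ∀ n, K.Adj (s n).1 (s n).2 := by
    rintro (_ | n)
    · exact h₀
    · rw [hs]; exact hadj _ _
  refine ⟨fun n => (s n).1, ?_, fun n => by simpa [hs n] using hsadj n⟩
  have key : ∀ i j, ∃ C D, SeparatesEdge G k (φ (s (i + j)).1) (φ (s (i + j)).2) C D ∧
      φ (s i).1 ∈ C := by
    intro i j
    induction j with
    | zero =>
      obtain ⟨A, B, hAB⟩ := hmin.exists_separatesEdge (φ.toHom.map_adj (hsadj i))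
      exact ⟨A, B, hAB, hAB.left_mem⟩
    | succ j ih =>
      obtain ⟨A, B, hAB, hA⟩ := ih
      obtain ⟨C, D, hCD, hAC⟩ := hmin.exists_superset_next φ hdeg hAB (hadj _ _) (hne _ _)
      refine ⟨C, D, ?_, hAC hA⟩
      rw [← add_assoc, hs]
      exact hCD
  suffices hlt : ∀ i j, i < j → (s i).1 ≠ (s j).1 from fun i j hij =>
    not_lt_iff_eq_or_lt.1 (fun h => hlt i j h hij) |>.resolve_right fun h => hlt j i h hij.symm
  intro i j hij heq
  obtain ⟨l, rfl⟩ := Nat.exists_eq_add_of_lt hij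
  obtain ⟨C, D, hCD, hC⟩ := key i l
  refine Set.disjoint_left.1 hCD.disjoint hC ?_
  have : (s i).1 = (s (i + l)).2 := by simpa [hs (i + l)] using heq
  rw [this]
  exact hCD.right_mem

end HighDegree

section Acyclic

variable {K : SimpleGraph V} {f g : ℕ → V}

theorem exists_walk_of_forall_adj (h : ∀ n, K.Adj (f n) (f (n + 1))) (i j : ℕ) :
    ∃ w : K.Walk (f i) (f j), ∀ v ∈ w.support, ∃ n, v = f n ∧ min i j ≤ n ∧ n ≤ max i j := by
  have key : ∀ i l, ∃ w : K.Walk (f i) (f (i + l)),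
      ∀ v ∈ w.support, ∃ n, v = f n ∧ i ≤ n ∧ n ≤ i + l := by
    intro i l
    induction l with
    | zero => exact ⟨.nil, fun v hv => ⟨i, by simpa using hv, le_rfl, le_rfl⟩⟩
    | succ l ih =>
      obtain ⟨w, hw⟩ := ih
      refine ⟨w.concat (h (i + l)), fun v hv => ?_⟩
      rw [Walk.support_concat, List.mem_append, List.mem_singleton] at hv
      rcases hv with hv | rfl
      · obtain ⟨n, hn, h₁, h₂⟩ := hw v hv
        exact ⟨n, hn, h₁, by omega⟩
      · exact ⟨i + l + 1, rfl, by omega, by omega⟩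
  rcases le_total i j with hij | hij
  · obtain ⟨l, rfl⟩ := Nat.exists_eq_add_of_le hij
    simpa using key i l
  · obtain ⟨l, rfl⟩ := Nat.exists_eq_add_of_le hij
    obtain ⟨w, hw⟩ := key j l
    exact ⟨w.reverse, by simpa using hw⟩

theorem SimpleGraph.IsAcyclic.mem_support_of_adj_of_adj (hK : K.IsAcyclic) {x y z : V}
    (hxy : K.Adj x y) (hyz : K.Adj y z) (hxz : x ≠ z) (p : K.Walk x z) : y ∈ p.support := by
  by_contra hy
  have h := isBridge_iff_forall_walk_mem_edges.1
    (isAcyclic_iff_forall_adj_isBridge.1 hK hxy) (p.concat hyz.symm)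
  rw [Walk.edges_concat, List.concat_eq_append, List.mem_append, List.mem_singleton] at h
  rcases h with h | h
  · exact hy (p.snd_mem_support_of_mem_edges h)
  · rcases Sym2.eq_iff.1 h with ⟨h, -⟩ | ⟨h, -⟩
    exacts [hxz h, hxy.ne h]

/-- In an acyclic graph, a ray eventually stays in every ray equivalent to it. -/
theorem SimpleGraph.IsAcyclic.exists_forall_mem_range (hK : K.IsAcyclic) (hf : IsRay K f)
    (hg : IsRay K g) (hfg : RayEquiv K f g) : ∃ N, ∀ n ≥ N, f n ∈ Set.range g := by
  classical
  obtain ⟨m, n, -, -, w, -⟩ := hfg ∅ 0 0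
  obtain ⟨N, hN⟩ := ((w.support.toFinset.finite_toSet.preimage hf.1.injOn).bddAbove)
  refine ⟨max N m + 1, fun l hl => ?_⟩
  by_contra hlg
  have hlw : f l ∉ w.support := fun h => by
    have := hN (show l ∈ f ⁻¹' _ by simpa using h)
    omega
  obtain ⟨m', n', hm', -, w', hw'⟩ := hfg {f l} (l + 1) 0
  obtain ⟨p₁, hp₁⟩ := exists_walk_of_forall_adj hf.2 (l - 1) m
  obtain ⟨p₂, hp₂⟩ := exists_walk_of_forall_adj hg.2 n n'
  obtain ⟨p₃, hp₃⟩ := exists_walk_of_forall_adj hf.2 m' (l + 1)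
  have hl₁ : K.Adj (f (l - 1)) (f l) := by
    have := hf.2 (l - 1)
    rwa [Nat.sub_add_cancel (by omega)] at this
  have h := hK.mem_support_of_adj_of_adj hl₁ (hf.2 l) (hf.1.ne (by omega))
    (p₁.append (w.append (p₂.append (w'.reverse.append p₃))))
  simp only [Walk.mem_support_append_iff, Walk.support_reverse, List.mem_reverse] at h
  rcases h with h | h | h | h | h
  · obtain ⟨i, hi, h₁, h₂⟩ := hp₁ _ h
    have := hf.1 hi
    omega
  · exact hlw h
  · obtain ⟨i, hi, -⟩ := hp₂ _ h
    exact hlg ⟨i, hi.symm⟩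
  · exact hw' _ h (by simp)
  · obtain ⟨i, hi, h₁, h₂⟩ := hp₃ _ h
    have := hf.1 hi
    omega

end Acyclic

/-- Every (nonempty) subgraph `H` of an infinite edge-minimally `k`-connected graph has a
vertex of degree at most `k` in `H`, or an end of vertex-degree `1` in `H`. -/
theorem stmt17 {V : Type u} [Infinite V] (G : SimpleGraph V) (k : ℕ)
    (hmin : EdgeMinKConnected G k) (H : G.Subgraph) (hne : H.verts.Nonempty) :
    (∃ x : H.verts, #(H.coe.neighborSet x) ≤ (k : Cardinal)) ∨
    (∃ f : ℕ → H.verts, IsRay H.coe f ∧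
      ¬ ∃ g h : ℕ → H.verts, IsRay H.coe g ∧ IsRay H.coe h ∧
        RayEquiv H.coe f g ∧ RayEquiv H.coe f h ∧
        Disjoint (Set.range g) (Set.range h)) := by
  rw [or_iff_not_imp_left]
  intro hno
  push Not at hno
  let φ : Copy H.coe G := H.hom.toCopy H.hom_injective
  have := hne.to_subtype
  have hK := hmin.isAcyclic φ hno
  obtain ⟨f, hf⟩ := hmin.exists_isRay φ hno
  refine ⟨f, hf, ?_⟩
  rintro ⟨g, h, hg, hh, hfg, hfh, hd⟩
  obtain ⟨M, hM⟩ := hK.exists_forall_mem_range hf hg hfg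
  obtain ⟨N, hN⟩ := hK.exists_forall_mem_range hf hh hfh
  exact Set.disjoint_left.1 hd (hM _ (le_max_left M N)) (hN _ (le_max_right M N))
end
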